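/- For every positive integer n, the number of representations of n by x1^2 + x2^2 + x3^2 + 2x4^2 + 4(x5^2+x6^2+x7^2+x8^2) equals (8/11)σ_{3;χ8,1}(n) + (2/11)σ_{3;1,χ8}(n/2) + (13/11)a1(n) + (45/11)a2(n) + (136/11)a1(n/2) + (16/11)a2(n/2), with terms of non-integer argument interpreted as 0. -/

import Mathlib

open Complex Real Finset

/-- The Dedekind eta function `η(z) = q^{1/24} ∏ (1 - q^m)`, `q = e^{2πiz}`. -/
noncomputable def dedekindEta (z : ℂ) : ℂ :=
  Complex.exp (Real.pi * Complex.I * z / 12) *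
    ∏' m : ℕ, (1 - Complex.exp (2 * Real.pi * Complex.I * (m + 1) * z))

/-- `repCount a n` is the number of `(x₁,…,x₈) ∈ ℤ⁸` with `∑ aᵢ xᵢ² = n`. -/
noncomputable def repCount (a : Fin 8 → ℕ) (n : ℕ) : ℕ :=
  Nat.card {x : Fin 8 → ℤ // ∑ i, (a i : ℤ) * x i ^ 2 = (n : ℤ)}

/-- `σ_{3;1,χ₈}(n) = ∑_{d ∣ n} χ₈(d) d³`. -/
def sigmaOneChi8 (n : ℕ) : ℤ := ∑ d ∈ n.divisors, ZMod.χ₈ (d : ZMod 8) * (d : ℤ) ^ 3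

/-- `σ_{3;χ₈,1}(n) = ∑_{d ∣ n} χ₈(n/d) d³`. -/
def sigmaChi8One (n : ℕ) : ℤ := ∑ d ∈ n.divisors, ZMod.χ₈ ((n / d : ℕ) : ZMod 8) * (d : ℤ) ^ 3

/-- `f(n/2)` when `2 ∣ n`, and `0` otherwise. -/
def half (f : ℕ → ℤ) (n : ℕ) : ℚ := if 2 ∣ n then (f (n / 2) : ℚ) else 0

namespace RF6
open Filter Topology

/-- `P z p = ∏_{n ≥ 0} (1 - z p^n)`. -/
noncomputable def P (z p : ℂ) : ℂ := ∏' n : ℕ, (1 - z * p ^ n)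

lemma summable_P (z : ℂ) {p : ℂ} (hp : ‖p‖ < 1) : Summable fun n : ℕ => ‖-(z * p ^ n)‖ := by
  simp only [norm_neg, norm_mul, norm_pow]
  exact (summable_geometric_of_lt_one (norm_nonneg _) hp).mul_left _

lemma mult_P (z : ℂ) {p : ℂ} (hp : ‖p‖ < 1) : Multipliable fun n : ℕ => (1 - z * p ^ n) := by
  simpa [sub_eq_add_neg] using multipliable_one_add_of_summable (summable_P z hp)

lemma P_ne_zero {z p : ℂ} (hp : ‖p‖ < 1) (h : ∀ n : ℕ, z * p ^ n ≠ 1) : P z p ≠ 0 := by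
  have := tprod_one_add_ne_zero_of_summable (f := fun n : ℕ => -(z * p ^ n)) (fun i hi => h i (by
    linear_combination -hi)) (summable_P z hp)
  simpa [P, sub_eq_add_neg] using this

lemma P_ne_zero' {z p : ℂ} (hp : ‖p‖ < 1) (hz : ‖z‖ < 1) : P z p ≠ 0 := by
  apply P_ne_zero hp
  intro n h
  have h1 : ‖z * p ^ n‖ < 1 := by
    rw [norm_mul, norm_pow]
    calc ‖z‖ * ‖p‖ ^ n ≤ ‖z‖ * 1 := by
          gcongr; exact pow_le_one₀ (norm_nonneg _) hp.le
      _ < 1 := by simpa using hz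
  rw [h] at h1; simp at h1

lemma P_shift (z : ℂ) {p : ℂ} (hp : ‖p‖ < 1) : P z p = (1 - z) * P (z * p) p := by
  unfold P
  rw [tprod_eq_zero_mul' (f := fun n : ℕ => (1 - z * p ^ n))]
  · simp [pow_succ', mul_assoc]
  · simpa [pow_succ', mul_assoc] using mult_P (z * p) hp

lemma P_sq (z : ℂ) {p : ℂ} (hp : ‖p‖ < 1) : P z p * P (-z) p = P (z ^ 2) (p ^ 2) := by
  unfold P
  rw [← (mult_P z hp).tprod_mul (mult_P (-z) hp)]
  congr 1; ext n; ring

lemma P_split (z : ℂ) {p : ℂ} (hp : ‖p‖ < 1) : P z p = P z (p ^ 2) * P (z * p) (p ^ 2) := by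
  have hp2 : ‖p ^ 2‖ < 1 := by rw [norm_pow]; exact pow_lt_one₀ (norm_nonneg _) hp (by norm_num)
  have h1 := (mult_P z hp2).hasProd
  have h2 := (mult_P (z * p) hp2).hasProd
  have e1 : (fun n : ℕ => 1 - z * (p ^ 2) ^ n) = fun k => 1 - z * p ^ (2 * k) := by
    ext k; rw [pow_mul]
  have e2 : (fun n : ℕ => 1 - z * p * (p ^ 2) ^ n) = fun k => 1 - z * p ^ (2 * k + 1) := by
    ext k; rw [pow_succ p (2 * k), pow_mul]; ring
  rw [e1] at h1
  rw [e2] at h2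
  have := HasProd.even_mul_odd (f := fun n : ℕ => (1 - z * p ^ n)) h1 h2
  unfold P
  rw [this.tprod_eq, e1, e2]

/-- Finite q-Pochhammer `(p;p)_n`. -/
noncomputable def poch (p : ℂ) (n : ℕ) : ℂ := ∏ i ∈ range n, (1 - p * p ^ i)

/-- Gaussian binomials by the q-Pascal rule. -/
noncomputable def gb (p : ℂ) : ℕ → ℕ → ℂ
  | _, 0 => 1
  | 0, _ + 1 => 0
  | M + 1, j + 1 => gb p M (j + 1) + p ^ (M - j) * gb p M j

lemma gb_zero_right (p : ℂ) (M : ℕ) : gb p M 0 = 1 := by cases M <;> simp [gb]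

lemma gb_gt (p : ℂ) : ∀ (M j : ℕ), M < j → gb p M j = 0 := by
  intro M
  induction M with
  | zero => intro j hj; cases j with
    | zero => omega
    | succ j => simp [gb]
  | succ M ih => intro j hj; cases j with
    | zero => omega
    | succ j => simp [gb, ih (j+1) (by omega), ih j (by omega)]

lemma poch_succ (p : ℂ) (n : ℕ) : poch p (n+1) = poch p n * (1 - p ^ (n+1)) := by
  simp [poch, prod_range_succ, pow_succ']

lemma gb_mul (p : ℂ) : ∀ (M j : ℕ), j ≤ M → gb p M j * (poch p j * poch p (M - j)) = poch p M := by
  intro M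
  induction M with
  | zero => intro j hj; obtain rfl : j = 0 := by omega
            simp [gb, poch]
  | succ M ih =>
    intro j hj
    cases j with
    | zero => simp [gb, poch]
    | succ j =>
      have h1 := ih j (by omega)
      rw [gb]
      rcases Nat.lt_or_ge j M with h | h
      · have h2 := ih (j+1) (by omega)
        obtain ⟨k, rfl⟩ : ∃ k, M = j + 1 + k := ⟨M - (j+1), by omega⟩
        have e1 : j + 1 + k - j = k + 1 := by omega
        have e2 : j + 1 + k - (j + 1) = k := by omega
        have e3 : j + 1 + k + 1 - (j + 1) = k + 1 := by omega
        rw [e1] at h1 ⊢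
        rw [e2] at h2
        rw [e3, poch_succ p (j+1+k), ← h1]
        rw [poch_succ p k, poch_succ p j] at *
        have e4 : p ^ (j+1+k+1) = p^(j+1) * p^(k+1) := by ring
        rw [e4]
        linear_combination (1 - p^(k+1)) * (h2 - h1)
      · obtain rfl : j = M := by omega
        rw [gb_gt p j (j+1) (by omega)]
        simp at h1 ⊢
        rw [poch_succ]
        linear_combination (1 - p^(j+1)) * h1

lemma qbinom (r x : ℂ) (M : ℕ) : ∏ k ∈ range M, (1 + x * (r^2) ^ k) =
    ∑ j ∈ range (M + 1), gb (r^2) M j * r ^ (j * (j - 1)) * x ^ j := by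
  induction M with
  | zero => simp [gb]
  | succ M ih =>
    rw [prod_range_succ, ih, sum_range_succ' _ (M+1), mul_add, mul_one]
    rw [sum_range_succ' (n := M)]
    simp only [gb_zero_right]
    have : ∀ j ∈ range (M+1), gb (r^2) (M+1) (j+1) * r ^ ((j+1) * (j+1-1)) * x ^ (j+1) =
       gb (r^2) M (j+1) * r ^ ((j+1) * (j+1-1)) * x ^ (j+1) +
       (gb (r^2) M j * r ^ (j * (j - 1)) * x ^ j) * (x * (r^2)^M) := by
      intro j hj
      rw [mem_range] at hj
      rw [gb]
      obtain ⟨k, rfl⟩ : ∃ k, M = j + k := ⟨M - j, by omega⟩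
      have e : (r^2)^k * r ^ ((j+1) * (j+1-1)) = r ^ (j * (j-1)) * (r^2)^(j+k) := by
        rw [← pow_mul, ← pow_mul, ← pow_add, ← pow_add]
        congr 1
        cases j with
        | zero => simp
        | succ j => simp; ring
      have e2 : j + k - j = k := by omega
      rw [e2]
      linear_combination (gb (r^2) (j+k) j * x^(j+1)) * e
    rw [sum_congr rfl this, sum_add_distrib, ← sum_mul]
    rw [sum_range_succ (fun j => gb (r^2) M (j+1) * r ^ ((j+1) * (j+1-1)) * x ^ (j+1)) M,
      gb_gt _ _ _ (Nat.lt_succ_self M)]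
    rw [sum_range_succ' (fun j => gb (r^2) M j * r ^ (j * (j - 1)) * x ^ j) M]
    simp only [gb_zero_right]
    ring

end RF6

namespace RF6
open Filter Topology

/-- `theta r z = ∑ (-1)^n r^(n²-n) z^n`. -/
noncomputable def theta (r z : ℂ) : ℂ := ∑' n : ℤ, (-1) ^ n * r ^ (n ^ 2 - n) * z ^ n

lemma summable_theta_nat {ρ x : ℝ} (h0 : 0 < ρ) (h1 : ρ < 1) (hx : 0 < x) :
    Summable fun n : ℕ => ρ ^ ((n:ℤ) ^ 2 - n) * x ^ n := by
  apply summable_of_ratio_test_tendsto_lt_one (l := 0) (by norm_num)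
  · filter_upwards with n
    positivity
  · have : ∀ n : ℕ, ‖ρ ^ (((n+1 : ℕ):ℤ) ^ 2 - (n+1 : ℕ)) * x ^ (n+1)‖ / ‖ρ ^ ((n:ℤ) ^ 2 - n) * x ^ n‖
        = (ρ ^ 2) ^ n * x := by
      intro n
      rw [Real.norm_of_nonneg (by positivity), Real.norm_of_nonneg (by positivity)]
      rw [div_eq_iff (by positivity)]
      have : ρ ^ (((n+1 : ℕ):ℤ) ^ 2 - (n+1 : ℕ)) = ρ ^ ((n:ℤ) ^ 2 - n) * (ρ ^ 2) ^ n := by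
        rw [← pow_mul, ← zpow_natCast, ← zpow_add₀ h0.ne']
        congr 1; push_cast; ring
      rw [this]; ring
    simp only [this]
    have h2 : Tendsto (fun n : ℕ => (ρ ^ 2) ^ n) atTop (𝓝 0) :=
      tendsto_pow_atTop_nhds_zero_of_lt_one (by positivity) (by nlinarith)
    simpa using h2.mul_const x

lemma summable_theta_real {ρ x : ℝ} (h0 : 0 < ρ) (h1 : ρ < 1) (hx : 0 < x) :
    Summable fun n : ℤ => ρ ^ (n ^ 2 - n) * x ^ n := by
  apply Summable.of_nat_of_neg
  · simpa using summable_theta_nat h0 h1 hx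
  · have := summable_theta_nat h0 h1 (x := ρ ^ 2 / x) (by positivity)
    refine this.congr fun n => ?_
    rw [div_pow, ← pow_mul, zpow_neg, zpow_natCast, ← zpow_natCast ρ, ← mul_div_assoc,
      ← zpow_add₀ h0.ne', div_eq_mul_inv]
    congr 2; push_cast; ring

lemma summable_theta_norm {r z : ℂ} (hr0 : r ≠ 0) (hr : ‖r‖ < 1) (hz : z ≠ 0) :
    Summable fun n : ℤ => ‖(-1) ^ n * r ^ (n ^ 2 - n) * z ^ n‖ := by
  simpa using summable_theta_real (norm_pos_iff.2 hr0) hr (norm_pos_iff.2 hz)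

lemma prod_reflect_aux {r z : ℂ} (hr0 : r ≠ 0) (hz : z ≠ 0) (N : ℕ) :
    ∏ k ∈ range N, (1 - z * (r^2) ^ (-(N:ℤ)) * (r^2) ^ k) =
    (-z) ^ N * r ^ (-((N:ℤ)^2 + N)) * ∏ k ∈ range N, (1 - (r ^ 2 / z) * (r^2) ^ k) := by
  rw [← prod_range_reflect]
  have h1 : ∀ k ∈ range N, (1 - z * (r^2) ^ (-(N:ℤ)) * (r^2) ^ (N - 1 - k)) =
      (-z * (r^2) ^ (-((k:ℤ)+1))) * (1 - (r ^ 2 / z) * (r^2) ^ k) := by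
    intro k hk
    rw [mem_range] at hk
    have e : (r^2) ^ (-(N:ℤ)) * (r^2) ^ (N - 1 - k) = (r^2) ^ (-((k:ℤ)+1)) := by
      rw [← zpow_natCast (r^2) (N - 1 - k), ← zpow_add₀ (pow_ne_zero 2 hr0)]
      congr 1; omega
    have e2 : (r^2) ^ (-((k:ℤ)+1)) * (r^2 * (r^2)^k) = 1 := by
      rw [← pow_succ', ← zpow_natCast (r^2) (k+1), ← zpow_add₀ (pow_ne_zero 2 hr0)]
      simp
    rw [mul_assoc, e]
    field_simp
    linear_combination -e2
  rw [prod_congr rfl h1, prod_mul_distrib]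
  congr 1
  clear h1
  induction N with
  | zero => simp
  | succ N ih =>
    rw [prod_range_succ, ih]
    have : r ^ (-(((N+1:ℕ):ℤ)^2 + (N+1:ℕ))) = r ^ (-((N:ℤ)^2 + N)) * (r^2) ^ (-((N:ℤ)+1)) := by
      rw [← zpow_natCast r 2, ← zpow_mul, ← zpow_add₀ hr0]
      congr 1; push_cast; ring
    rw [this]; ring

/-- truncated coefficients -/
noncomputable def gc (p : ℂ) (N : ℕ) (m : ℤ) : ℂ :=
  if m ∈ Finset.Icc (-(N:ℤ)) N then gb p (2 * N) ((N + m).toNat) else 0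

lemma finite_jtp {r z : ℂ} (hr0 : r ≠ 0) (hz : z ≠ 0) (N : ℕ) :
    (∏ k ∈ range N, (1 - z * (r^2) ^ k)) * (∏ k ∈ range N, (1 - (r ^ 2 / z) * (r^2) ^ k)) =
    ∑' m : ℤ, gc (r^2) N m * ((-1) ^ m * r ^ (m ^ 2 - m) * z ^ m) := by
  have h := qbinom r (-(z * (r^2) ^ (-(N:ℤ)))) (N + N)
  rw [prod_range_add] at h
  have h1 : ∏ k ∈ range N, (1 + -(z * (r^2) ^ (-(N:ℤ))) * (r^2) ^ k) =
    (-z) ^ N * r ^ (-((N:ℤ)^2 + N)) * ∏ k ∈ range N, (1 - (r ^ 2 / z) * (r^2) ^ k) := by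
    rw [← prod_reflect_aux hr0 hz]
    exact prod_congr rfl fun k _ => by ring
  have h2 : ∏ k ∈ range N, (1 + -(z * (r^2) ^ (-(N:ℤ))) * (r^2) ^ (N + k)) =
      ∏ k ∈ range N, (1 - z * (r^2) ^ k) := by
    refine prod_congr rfl fun k _ => ?_
    have : (r^2) ^ (-(N:ℤ)) * (r^2) ^ (N + k) = (r^2)^k := by
      rw [← zpow_natCast (r^2) (N+k), ← zpow_natCast (r^2) k, ← zpow_add₀ (pow_ne_zero 2 hr0)]
      congr 1; push_cast; ring
    linear_combination -z * this
  rw [h1, h2] at h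
  have hc : (-z) ^ N * r ^ (-((N:ℤ)^2 + N)) ≠ 0 :=
    mul_ne_zero (pow_ne_zero _ (neg_ne_zero.2 hz)) (zpow_ne_zero _ hr0)
  apply mul_left_cancel₀ hc
  rw [tsum_eq_sum (s := Finset.Icc (-(N:ℤ)) N)]
  swap
  · intro m hm
    simp [gc, hm]
  rw [mul_sum]
  trans ∑ j ∈ range (N + N + 1),
    gb (r ^ 2) (N + N) j * r ^ (j * (j - 1)) * (-(z * (r ^ 2) ^ (-(N:ℤ)))) ^ j
  · rw [← h]; ring
  refine sum_nbij' (fun j : ℕ => (j:ℤ) - N) (fun m => (N + m).toNat) ?_ ?_ ?_ ?_ ?_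
  · intro j hj; simp only [mem_range] at hj; simp; omega
  · intro j hj; simp only [Finset.mem_Icc] at hj; simp; omega
  · intro j hj; simp
  · intro j hj; simp only [Finset.mem_Icc] at hj; simp; omega
  · intro j hj
    simp only [mem_range] at hj
    have hm : (j:ℤ) - N ∈ Finset.Icc (-(N:ℤ)) N := by simp; omega
    rw [gc, if_pos hm]
    have e1 : ((N:ℤ) + (j - N)).toNat = j := by simp
    rw [e1, two_mul]
    have e2 : (-(z * (r ^ 2) ^ (-(N:ℤ)))) ^ j = (-z) ^ j * r ^ (-(2 * (N:ℤ) * j)) := by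
      rw [← neg_mul, mul_pow, ← zpow_natCast r 2, ← zpow_mul, ← zpow_natCast _ j, ← zpow_natCast _ j, ← zpow_mul]
      congr 2; push_cast; ring
    have e3 : (r:ℂ) ^ (j * (j - 1)) = r ^ ((j:ℤ)^2 - j) := by
      rw [← zpow_natCast]
      congr 1
      cases j with
      | zero => simp
      | succ j => push_cast [Nat.add_sub_cancel]; ring
    have e4 : (-1 : ℂ) ^ ((j:ℤ) - N) * z ^ ((j:ℤ) - N) * (-z) ^ N = (-z) ^ j := by
      rw [← mul_zpow, ← zpow_natCast, ← zpow_natCast, neg_one_mul, ← zpow_add₀ (neg_ne_zero.2 hz)]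
      congr 1; ring
    have e5 : (r:ℂ) ^ ((j:ℤ)^2 - j) * r ^ (-(2 * (N:ℤ) * j)) =
        r ^ (-((N:ℤ)^2 + N)) * r ^ (((j:ℤ) - N)^2 - (j - N)) := by
      rw [← zpow_add₀ hr0, ← zpow_add₀ hr0]; congr 1; ring
    rw [e2, e3]
    calc _ = gb (r^2) (N+N) j * (-z)^j * ((r:ℂ) ^ ((j:ℤ)^2 - j) * r ^ (-(2 * (N:ℤ) * j))) := by ring
      _ = _ := by rw [e5, ← e4]; ring

lemma poch_tendsto {p : ℂ} (hp : ‖p‖ < 1) : Tendsto (poch p) atTop (𝓝 (P p p)) :=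
  (mult_P p hp).hasProd.tendsto_prod_nat

lemma poch_ne_zero {p : ℂ} (hp : ‖p‖ < 1) (n : ℕ) : poch p n ≠ 0 := by
  unfold poch
  rw [prod_ne_zero_iff]
  intro i _ h
  have h1 : p ^ (i+1) = 1 := by rw [pow_succ']; linear_combination -h
  have : ‖p ^ (i+1)‖ < 1 := by rw [norm_pow]; exact pow_lt_one₀ (norm_nonneg _) hp (by omega)
  rw [h1] at this; simp at this

lemma bdd_of_tendsto {f : ℕ → ℂ} {l : ℂ} (h : Tendsto f atTop (𝓝 l)) : ∃ C, 0 < C ∧ ∀ n, ‖f n‖ ≤ C := by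
  obtain ⟨C, hC⟩ := (Metric.isBounded_range_of_tendsto f h).exists_norm_le
  exact ⟨max C 1, by positivity, fun n => le_max_of_le_left (hC _ ⟨n, rfl⟩)⟩

lemma gb_eq {p : ℂ} (hp : ‖p‖ < 1) {M j : ℕ} (h : j ≤ M) :
    gb p M j = poch p M * (poch p j)⁻¹ * (poch p (M-j))⁻¹ := by
  rw [← gb_mul p M j h]
  field_simp [poch_ne_zero hp]

lemma jtp {r z : ℂ} (hr0 : r ≠ 0) (hr : ‖r‖ < 1) (hz : z ≠ 0) :
    theta r z = P (r^2) (r^2) * P z (r^2) * P (r^2 / z) (r^2) := by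
  have hp : ‖r^2‖ < 1 := by rw [norm_pow]; exact pow_lt_one₀ (norm_nonneg _) hr (by norm_num)
  set p := r^2 with hpdef
  have hE : P p p ≠ 0 := P_ne_zero' hp hp
  have hinv : Tendsto (fun n => (poch p n)⁻¹) atTop (𝓝 (P p p)⁻¹) := (poch_tendsto hp).inv₀ hE
  obtain ⟨C1, hC1, hb1⟩ := bdd_of_tendsto (poch_tendsto hp)
  obtain ⟨C2, hC2, hb2⟩ := bdd_of_tendsto hinv
  have hT : Tendsto (fun N => ∑' m : ℤ, gc p N m * ((-1) ^ m * r ^ (m ^ 2 - m) * z ^ m)) atTop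
      (𝓝 (∑' m : ℤ, (P p p)⁻¹ * ((-1) ^ m * r ^ (m ^ 2 - m) * z ^ m))) := by
    apply tendsto_tsum_of_dominated_convergence
      ((summable_theta_norm hr0 hr hz).mul_left (C1 * C2 * C2))
    · intro m
      apply Tendsto.mul_const
      have h1 : Tendsto (fun N : ℕ => poch p (2*N) * (poch p ((N:ℤ)+m).toNat)⁻¹ * (poch p ((N:ℤ)-m).toNat)⁻¹)
          atTop (𝓝 (P p p * (P p p)⁻¹ * (P p p)⁻¹)) := by
        refine ((poch_tendsto hp).comp ?_ |>.mul (hinv.comp ?_)).mul (hinv.comp ?_)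
        · exact tendsto_atTop_mono (fun N : ℕ => (by simp; omega : id N ≤ 2 * N)) tendsto_id
        · exact tendsto_atTop_atTop.2 fun b => ⟨b + m.natAbs, fun a ha => by omega⟩
        · exact tendsto_atTop_atTop.2 fun b => ⟨b + m.natAbs, fun a ha => by omega⟩
      rw [mul_inv_cancel₀ hE, one_mul] at h1
      refine h1.congr' ?_
      filter_upwards [eventually_ge_atTop m.natAbs] with N hN
      have hm : m ∈ Finset.Icc (-(N:ℤ)) N := by simp; omega
      rw [gc, if_pos hm, gb_eq hp (by omega)]
      congr 4; omega
    · filter_upwards with N m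
      rw [norm_mul]
      gcongr
      rw [gc]
      split_ifs with hm
      · rw [Finset.mem_Icc] at hm
        rw [gb_eq hp (by omega), norm_mul, norm_mul]
        gcongr
        · exact hb1 _
        · exact hb2 _
        · exact hb2 _
      · simp; positivity
  have hT2 : Tendsto (fun N => ∑' m : ℤ, gc p N m * ((-1) ^ m * r ^ (m ^ 2 - m) * z ^ m)) atTop
      (𝓝 (P z p * P (p / z) p)) := by
    have := ((mult_P z hp).hasProd.tendsto_prod_nat).mul ((mult_P (p / z) hp).hasProd.tendsto_prod_nat)
    refine this.congr fun N => ?_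
    rw [hpdef]
    exact finite_jtp hr0 hz N
  have := tendsto_nhds_unique hT hT2
  rw [tsum_mul_left] at this
  rw [mul_assoc, ← this]
  unfold theta
  field_simp

end RF6

namespace RF6
open Filter Topology

lemma int_ind {Q : ℤ → Prop} (h0 : Q 0) (hs : ∀ n, Q n ↔ Q (n + 1)) : ∀ n, Q n := by
  intro n
  induction n using Int.induction_on with
  | zero => exact h0
  | succ i ih => exact (hs _).1 ih
  | pred i ih => exact (hs _).2 (by simpa using ih)

/-- `1/(1 - y p^k)` -/
noncomputable def h (y p : ℂ) (k : ℤ) : ℂ := (1 - y * p ^ k)⁻¹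

lemma h_bdd {y p : ℂ} (hy : y ≠ 0) (hp0 : p ≠ 0) (hp : ‖p‖ < 1) : ∃ C, 0 < C ∧ ∀ k, ‖h y p k‖ ≤ C := by
  have hp' : Tendsto (fun n : ℕ => p ^ n) atTop (𝓝 0) := tendsto_pow_atTop_nhds_zero_of_norm_lt_one hp
  have h1 : Tendsto (fun n : ℕ => h y p n) atTop (𝓝 (1 - y * 0)⁻¹) := by
    simp only [h, zpow_natCast]
    exact (tendsto_const_nhds.sub (hp'.const_mul y)).inv₀ (by simp)
  have h2 : Tendsto (fun n : ℕ => h y p (-n)) atTop (𝓝 (0 * (0 - y)⁻¹)) := by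
    have : (fun n : ℕ => h y p (-n)) = fun n : ℕ => p ^ n * (p ^ n - y)⁻¹ := by
      ext n
      have hn : p ^ n ≠ 0 := pow_ne_zero _ hp0
      rw [h, zpow_neg, zpow_natCast, show 1 - y * (p ^ n)⁻¹ = (p^n - y) * (p^n)⁻¹ by field_simp,
        mul_inv, inv_inv, mul_comm]
    rw [this]
    exact hp'.mul ((hp'.sub tendsto_const_nhds).inv₀ (by simpa using hy))
  obtain ⟨C1, hC1, hb1⟩ := bdd_of_tendsto h1
  obtain ⟨C2, hC2, hb2⟩ := bdd_of_tendsto h2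
  refine ⟨C1 + C2, by positivity, fun k => ?_⟩
  obtain ⟨n, rfl | rfl⟩ := k.eq_nat_or_neg
  · linarith [hb1 n]
  · linarith [hb2 n]

lemma h_rel {y p : ℂ} {k : ℤ} (hk : y * p ^ k ≠ 1) : h y p k - 1 = y * p ^ k * h y p k := by
  have : 1 - y * p ^ k ≠ 0 := sub_ne_zero.2 (Ne.symm hk)
  rw [h]; field_simp; ring

lemma h_est {y p : ℂ} (hy : y ≠ 0) (hp0 : p ≠ 0) (hp : ‖p‖ < 1) : ∃ C, 0 < C ∧ ∀ k, ‖h y p k‖ ≤ C ∧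
    ‖h y p k‖ ≤ C * ‖p‖ ^ (-k) ∧ (y * p ^ k ≠ 1 → ‖h y p k - 1‖ ≤ C * ‖p‖ ^ k) := by
  obtain ⟨C, hC, hb⟩ := h_bdd hy hp0 hp
  have hy' : 0 < ‖y‖ := norm_pos_iff.2 hy
  have hp' : 0 < ‖p‖ := norm_pos_iff.2 hp0
  refine ⟨C + C * ‖y‖ + (C + 1) / ‖y‖, by positivity, fun k => ⟨?_, ?_, ?_⟩⟩
  · have : 0 ≤ C * ‖y‖ := by positivity
    have : 0 ≤ (C + 1) / ‖y‖ := by positivity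
    linarith [hb k]
  · by_cases hk : y * p ^ k = 1
    · simp [h, hk]; positivity
    · have h1 := h_rel hk
      have h2 : h y p k = (h y p k - 1) * y⁻¹ * p ^ (-k) := by
        rw [h1, zpow_neg]
        have : p ^ k ≠ 0 := zpow_ne_zero _ hp0
        field_simp
      rw [h2, norm_mul, norm_mul, norm_zpow, norm_inv]
      gcongr
      calc ‖h y p k - 1‖ * ‖y‖⁻¹ ≤ (C + 1) * ‖y‖⁻¹ := by
            gcongr
            refine (norm_sub_le _ _).trans ?_
            rw [norm_one]; linarith [hb k]
        _ ≤ _ := by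
            have : 0 ≤ C * ‖y‖ := by positivity
            rw [← div_eq_mul_inv]; linarith
  · intro hk
    rw [h_rel hk, norm_mul, norm_mul, norm_zpow]
    have : 0 ≤ (C + 1) / ‖y‖ := by positivity
    calc ‖y‖ * ‖p‖ ^ k * ‖h y p k‖ ≤ ‖y‖ * ‖p‖ ^ k * C := by gcongr; exact hb k
      _ = (C * ‖y‖) * ‖p‖ ^ k := by ring
      _ ≤ _ := by gcongr; linarith

lemma summable_pow_geom (m : ℕ) {x : ℝ} (h0 : 0 ≤ x) (h1 : x < 1) : Summable fun n : ℕ => (n:ℝ) ^ m * x ^ n :=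
  summable_pow_mul_geometric_of_norm_lt_one m (by rwa [Real.norm_of_nonneg h0])

lemma summable_h (m : ℕ) {y p z : ℂ} (hy : y ≠ 0) (hp0 : p ≠ 0) (hp : ‖p‖ < 1) (hz1 : ‖p‖ < ‖z‖)
    (hz2 : ‖z‖ < 1) : Summable fun k : ℤ => ‖(k:ℂ) ^ m * h y p k * z ^ k‖ := by
  obtain ⟨C, hC, hb⟩ := h_est hy hp0 hp
  have hp' : 0 < ‖p‖ := norm_pos_iff.2 hp0
  have hz0 : 0 < ‖z‖ := hp'.trans hz1
  apply Summable.of_nat_of_neg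
  · refine Summable.of_nonneg_of_le (fun _ => norm_nonneg _) (fun n => ?_)
      ((summable_pow_geom m hz0.le hz2).mul_left C)
    simp only [norm_mul, norm_pow, zpow_natCast, Int.cast_natCast, Complex.norm_natCast]
    calc _ ≤ (n:ℝ)^m * C * ‖z‖^n := by gcongr; exact (hb _).1
      _ = _ := by ring
  · refine Summable.of_nonneg_of_le (fun _ => norm_nonneg _) (fun n => ?_)
      ((summable_pow_geom m (x := ‖p‖ / ‖z‖) (by positivity) (by rwa [div_lt_one hz0])).mul_left C)
    simp only [norm_mul, norm_pow, zpow_neg, zpow_natCast, Int.cast_neg, norm_neg, Int.cast_natCast,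
      Complex.norm_natCast, norm_inv]
    calc _ ≤ (n:ℝ)^m * (C * ‖p‖^n) * (‖z‖^n)⁻¹ := by
            gcongr
            simpa using (hb (-n)).2.1
      _ = _ := by rw [div_pow]; field_simp

lemma conv {f g : ℤ → ℂ} (hf : Summable fun k => ‖f k‖) (hg : Summable fun k => ‖g k‖) :
    HasSum (fun N => ∑' j, f j * g (N - j)) ((∑' k, f k) * ∑' k, g k) := by
  have hs := summable_mul_of_summable_norm hf hg
  let e : ℤ × ℤ ≃ ℤ × ℤ :=
    { toFun := fun x => (x.2, x.1 - x.2)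
      invFun := fun x => (x.1 + x.2, x.1)
      left_inv := fun x => by ext <;> simp
      right_inv := fun x => by ext <;> simp }
  have h1 : HasSum (fun x : ℤ × ℤ => f x.1 * g x.2) ((∑' k, f k) * ∑' k, g k) := by
    rw [tsum_mul_tsum_of_summable_norm hf hg]; exact hs.hasSum
  have h2 := (e.hasSum_iff).2 h1
  exact h2.prod_fiberwise fun b => (h2.summable.prod_factor b).hasSum

/-- `F` -/
noncomputable def F (y p z : ℂ) : ℂ := ∑' k : ℤ, h y p k * z ^ k

/-- `R` -/
noncomputable def R (r y : ℂ) : ℂ := ∑' n : ℤ, (-1) ^ n * r ^ (n ^ 2 + n) * h y (r^2) n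

/-- `J` -/
noncomputable def J (m : ℕ) (p z : ℂ) : ℂ := ∑' k : ℤ, (k:ℂ) ^ m * h 1 p k * z ^ k

lemma norm_sq_lt {r : ℂ} (hr : ‖r‖ < 1) : ‖r^2‖ < 1 := by
  rw [norm_pow]; exact pow_lt_one₀ (norm_nonneg _) hr (by norm_num)

lemma theta_one {r : ℂ} (hr0 : r ≠ 0) (hr : ‖r‖ < 1) : theta r 1 = 0 := by
  rw [jtp hr0 hr one_ne_zero, P_shift 1 (norm_sq_lt hr)]; simp

lemma theta_inv {r z : ℂ} (hr0 : r ≠ 0) (hr : ‖r‖ < 1) (hz : z ≠ 0) : theta r z⁻¹ = - theta r z / z := by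
  rw [jtp hr0 hr hz, jtp hr0 hr (inv_ne_zero hz), P_shift z (norm_sq_lt hr), P_shift z⁻¹ (norm_sq_lt hr)]
  have e1 : r ^ 2 / z⁻¹ = z * r ^ 2 := by field_simp
  have e2 : z⁻¹ * r ^ 2 = r ^ 2 / z := by field_simp
  rw [e1, e2]
  field_simp
  ring

lemma neg_one_zpow_ne (n : ℤ) : ((-1 : ℂ)) ^ n ≠ 0 := zpow_ne_zero _ (by norm_num)

lemma summable_R {r y : ℂ} (hr0 : r ≠ 0) (hr : ‖r‖ < 1) (hy : y ≠ 0) :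
    Summable fun n : ℤ => (-1 : ℂ) ^ n * r ^ (n ^ 2 + n) * h y (r^2) n := by
  obtain ⟨C, hC, hb⟩ := h_bdd hy (pow_ne_zero 2 hr0) (norm_sq_lt hr)
  have := (summable_theta_norm hr0 hr (z := r^2) (pow_ne_zero 2 hr0)).mul_left C
  refine this.of_norm_bounded fun n => ?_
  rw [norm_mul, mul_comm C]
  gcongr
  · have : (-1 : ℂ) ^ n * r ^ (n ^ 2 + n) = (-1) ^ n * r ^ (n^2 - n) * (r^2)^n := by
      rw [mul_assoc, ← zpow_natCast r 2, ← zpow_mul, ← zpow_add₀ hr0]; congr 2; push_cast; ring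
    rw [this]
  · exact hb n

lemma R_shift {r y : ℂ} (hr0 : r ≠ 0) (hr : ‖r‖ < 1) (hy : y ≠ 0) (hyp : ∀ n : ℤ, y * (r^2)^n ≠ 1) :
    R r (y * r^2) = - y * R r y := by
  have hr2 : r^2 ≠ 0 := pow_ne_zero 2 hr0
  have h0 := theta_one hr0 hr
  have hs1 := (summable_theta_norm hr0 hr one_ne_zero).of_norm
  have hs2 := (summable_R hr0 hr hy).mul_left y
  have : R r (y * r^2) = ∑' n : ℤ, (-((-1) ^ n * r ^ (n ^ 2 - n) * 1 ^ n
      + y * ((-1) ^ n * r ^ (n ^ 2 + n) * h y (r^2) n))) := by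
    unfold R
    rw [← (Equiv.addRight (1:ℤ)).tsum_eq (fun n : ℤ => -((-1) ^ n * r ^ (n ^ 2 - n) * 1 ^ n
      + y * ((-1) ^ n * r ^ (n ^ 2 + n) * h y (r^2) n)))]
    congr 1; ext n
    simp only [Equiv.coe_addRight, one_zpow, mul_one]
    have e1 : h (y * r^2) (r^2) n = h y (r^2) (n+1) := by
      rw [h, h, zpow_add_one₀ hr2]; congr 2; ring
    rw [e1]
    have e2 := h_rel (hyp (n+1))
    have e3 : r ^ ((n+1)^2 - (n+1)) = r ^ (n^2 + n) := by congr 1; ring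
    have e4 : r ^ ((n+1)^2 + (n+1)) = r ^ (n^2 + n) * (r^2)^(n+1) := by
      rw [← zpow_natCast r 2, ← zpow_mul, ← zpow_add₀ hr0]; congr 1; push_cast; ring
    rw [e3, e4, zpow_add_one₀ (by norm_num : (-1:ℂ) ≠ 0)]
    linear_combination ((-1)^n * r ^ (n^2+n)) * e2
  rw [this, tsum_neg, Summable.tsum_add hs1 hs2, tsum_mul_left]
  have h0' : ∑' n : ℤ, (-1:ℂ) ^ n * r ^ (n ^ 2 - n) * 1 ^ n = 0 := h0
  rw [h0']
  unfold R; ring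

lemma R_zpow {r y : ℂ} (hr0 : r ≠ 0) (hr : ‖r‖ < 1) (hy : y ≠ 0) (hyp : ∀ n : ℤ, y * (r^2)^n ≠ 1) (N : ℤ) :
    R r (y * (r^2)^N) = (-1)^N * r ^ (N^2 - N) * y ^ N * R r y := by
  have hr2 : r^2 ≠ 0 := pow_ne_zero 2 hr0
  revert N
  apply int_ind
  · simp
  · intro N
    have h1 : R r (y * (r^2)^(N+1)) = - (y * (r^2)^N) * R r (y * (r^2)^N) := by
      rw [zpow_add_one₀ hr2, ← mul_assoc]
      apply R_shift hr0 hr (mul_ne_zero hy (zpow_ne_zero _ hr2))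
      intro n
      rw [mul_assoc, ← zpow_add₀ hr2]; exact hyp _
    have h2 : (-1)^(N+1) * r ^ ((N+1)^2 - (N+1)) * y ^ (N+1) * R r y = - (y * (r^2)^N) *
        ((-1)^N * r ^ (N^2 - N) * y ^ N * R r y) := by
      have e4 : r ^ ((N+1)^2 - (N+1)) = r ^ (N^2 - N) * (r^2)^N := by
        rw [← zpow_natCast r 2, ← zpow_mul, ← zpow_add₀ hr0]; congr 1; push_cast; ring
      rw [e4, zpow_add_one₀ (by norm_num : (-1:ℂ) ≠ 0), zpow_add_one₀ hy]; ring
    rw [h1, h2]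
    exact (mul_right_inj' (neg_ne_zero.2 (mul_ne_zero hy (zpow_ne_zero _ hr2)))).symm

lemma R_inv {r y : ℂ} (hr0 : r ≠ 0) (hy : y ≠ 0) : R r y⁻¹ = - y * R r y := by
  unfold R
  rw [← (Equiv.neg ℤ).tsum_eq, ← tsum_mul_left]
  congr 1; ext n
  have hr2 : (r^2)^n ≠ 0 := zpow_ne_zero _ (pow_ne_zero 2 hr0)
  have e4 : r ^ (n^2 + n) = r ^ (n^2 - n) * (r^2)^n := by
    rw [← zpow_natCast r 2, ← zpow_mul, ← zpow_add₀ hr0]; congr 1; push_cast; ring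
  have e3 : r ^ ((-n)^2 + -n) = r ^ (n^2 - n) := by congr 1; ring
  have e5 : h y⁻¹ (r^2) (-n) = - (y * (r^2)^n) * h y (r^2) n := by
    rw [h, h, zpow_neg, ← mul_inv]
    have : y * (r^2)^n ≠ 0 := mul_ne_zero hy hr2
    generalize y * (r^2)^n = x at *
    rw [show 1 - x⁻¹ = -(x⁻¹ * (1 - x)) by field_simp; ring, inv_neg, mul_inv, inv_inv]; ring
  have e6 : (-1:ℂ)^(-n) = (-1)^n := by rw [zpow_neg, ← inv_zpow]; norm_num
  simp only [Equiv.neg_apply]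
  rw [e3, e4, e5, e6]; ring

lemma F_theta {r y z : ℂ} (hr0 : r ≠ 0) (hr : ‖r‖ < 1) (hy : y ≠ 0) (hyp : ∀ n : ℤ, y * (r^2)^n ≠ 1)
    (hz1 : ‖r^2‖ < ‖z‖) (hz2 : ‖z‖ < 1) :
    F y (r^2) z * theta r z = R r y * theta r (y * z) := by
  have hr2 : r^2 ≠ 0 := pow_ne_zero 2 hr0
  have hz0 : z ≠ 0 := norm_pos_iff.1 ((norm_pos_iff.2 hr2).trans hz1)
  have hs := summable_h 0 hy hr2 (norm_sq_lt hr) hz1 hz2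
  simp only [pow_zero, one_mul] at hs
  have hc := conv (summable_theta_norm hr0 hr hz0) hs
  have : ∀ N : ℤ, ∑' j : ℤ, ((-1) ^ j * r ^ (j ^ 2 - j) * z ^ j) * (h y (r^2) (N - j) * z ^ (N - j)) =
      R r y * ((-1) ^ N * r ^ (N ^ 2 - N) * (y * z) ^ N) := by
    intro N
    have e : R r y * ((-1) ^ N * r ^ (N ^ 2 - N) * (y * z) ^ N) = z ^ N * R r (y * (r^2)^N) := by
      rw [R_zpow hr0 hr hy hyp, mul_zpow]; ring
    rw [e]
    unfold R
    rw [← (Equiv.neg ℤ).tsum_eq, ← tsum_mul_left]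
    congr 1; ext n
    have e6 : (-1:ℂ)^(-n) = (-1)^n := by rw [zpow_neg, ← inv_zpow]; norm_num
    have e3 : r ^ ((-n)^2 - -n) = r ^ (n^2 + n) := by congr 1; ring
    have e7 : z ^ (-n) * z ^ (N - -n) = z ^ N := by rw [← zpow_add₀ hz0]; congr 1; ring
    have e8 : h (y * (r^2)^N) (r^2) n = h y (r^2) (N - -n) := by
      rw [h, h, mul_assoc, ← zpow_add₀ hr2]; congr 4; ring
    simp only [Equiv.neg_apply]
    rw [e6, e3, e8, ← e7]; ring
  simp only [this] at hc
  have := hc.tsum_eq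
  rw [tsum_mul_left] at this
  unfold F
  rw [mul_comm]
  exact this.symm

end RF6

namespace RF6
open Filter Topology

lemma summable_abs (m : ℕ) {x : ℝ} (h0 : 0 ≤ x) (h1 : x < 1) :
    Summable fun k : ℤ => (k.natAbs:ℝ) ^ m * x ^ k.natAbs := by
  apply Summable.of_nat_of_neg
  · simpa using summable_pow_geom m h0 h1
  · simpa using summable_pow_geom m h0 h1

lemma hs_congr {ι : Type*} {f g : ι → ℂ} {a b : ℂ} (hf : HasSum f a) (h1 : ∀ j, g j = f j) (h2 : b = a) :
    HasSum g b := by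
  rw [funext h1, h2]; exact hf

/-- step function -/
noncomputable def st (k : ℤ) : ℂ := if 0 < k then 1 else 0

/-- the deviation of `h` from the step function -/
noncomputable def e (y p : ℂ) (k : ℤ) : ℂ := h y p k - st k

lemma h_eq (y p : ℂ) (k : ℤ) : h y p k = st k + e y p k := by simp [e]

lemma e_est {y p : ℂ} (hy : y ≠ 0) (hp0 : p ≠ 0) (hp : ‖p‖ < 1) (hyp : ∀ n : ℤ, 0 < n → y * p ^ n ≠ 1) :
    ∃ C, 0 < C ∧ ∀ k, ‖e y p k‖ ≤ C * ‖p‖ ^ k.natAbs := by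
  obtain ⟨C, hC, hb⟩ := h_est hy hp0 hp
  refine ⟨C, hC, fun k => ?_⟩
  obtain ⟨h1, h2, h3⟩ := hb k
  unfold e st
  split_ifs with hk
  · convert h3 (hyp k hk) using 2
    rw [← zpow_natCast]; congr 1; omega
  · rw [sub_zero]
    convert h2 using 2
    rw [← zpow_natCast]; congr 1; omega

lemma summable_e (m : ℕ) {y p : ℂ} (hy : y ≠ 0) (hp0 : p ≠ 0) (hp : ‖p‖ < 1)
    (hyp : ∀ n : ℤ, 0 < n → y * p ^ n ≠ 1) : Summable fun k : ℤ => (k:ℂ) ^ m * e y p k := by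
  obtain ⟨C, hC, hb⟩ := e_est hy hp0 hp hyp
  refine ((summable_abs m (norm_nonneg p) hp).mul_left C).of_norm_bounded fun k => ?_
  rw [norm_mul, norm_pow]
  have : ‖(k:ℂ)‖ = k.natAbs := by rw [Complex.norm_intCast]; simp [Nat.cast_natAbs]
  rw [this]
  calc _ ≤ (k.natAbs:ℝ)^m * (C * ‖p‖ ^ k.natAbs) := by gcongr; exact hb k
    _ = _ := by ring

lemma st_sub (k : ℤ) : st k - st (k - 1) = if k = 1 then 1 else 0 := by
  unfold st
  split_ifs <;> first | omega | simp

lemma hasSum_st (N : ℤ) : HasSum (fun j : ℤ => st j - st (j - N)) (N : ℂ) := by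
  revert N
  apply int_ind
  · simpa using hasSum_zero
  · intro N
    have h1 : HasSum (fun j : ℤ => st (j - N) - st (j - (N + 1))) 1 := by
      have : (fun j : ℤ => st (j - N) - st (j - (N + 1))) = fun j => if j = N + 1 then (1:ℂ) else 0 := by
        ext j
        rw [show j - (N + 1) = (j - N) - 1 by ring, st_sub]
        congr 1; simp; omega
      rw [this]; exact hasSum_ite_eq _ _
    constructor
    · intro hN
      exact hs_congr (hN.add h1) (fun j => by ring) (by push_cast; ring)
    · intro hN
      exact hs_congr (hN.sub h1) (fun j => by ring) (by push_cast; ring)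

lemma hasSum_st1 (N : ℤ) : HasSum (fun j : ℤ => (j:ℂ) * (st j - st (j - N))) ((N:ℂ) * (N + 1) / 2) := by
  revert N
  apply int_ind
  · simpa using hasSum_zero
  · intro N
    have h1 : HasSum (fun j : ℤ => (j:ℂ) * (st (j - N) - st (j - (N + 1)))) (N+1:ℂ) := by
      have : (fun j : ℤ => (j:ℂ) * (st (j - N) - st (j - (N + 1)))) = fun j => if j = N + 1 then (N+1:ℂ) else 0 := by
        ext j
        rw [show j - (N + 1) = (j - N) - 1 by ring, st_sub]
        by_cases hj : j = N + 1
        · simp [hj]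
        · rw [if_neg (by omega), if_neg hj, mul_zero]
      rw [this]; exact hasSum_ite_eq _ _
    constructor
    · intro hN
      exact hs_congr (hN.add h1) (fun j => by ring) (by push_cast; ring)
    · intro hN
      exact hs_congr (hN.sub h1) (fun j => by ring) (by push_cast; ring)

lemma hasSum_st2 (N : ℤ) :
    HasSum (fun j : ℤ => (j:ℂ)^2 * (st j - st (j - N))) ((N:ℂ) * (N + 1) * (2 * N + 1) / 6) := by
  revert N
  apply int_ind
  · simpa using hasSum_zero
  · intro N
    have h1 : HasSum (fun j : ℤ => (j:ℂ)^2 * (st (j - N) - st (j - (N + 1)))) ((N+1:ℂ)^2) := by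
      have : (fun j : ℤ => (j:ℂ)^2 * (st (j - N) - st (j - (N + 1)))) =
          fun j => if j = N + 1 then (N+1:ℂ)^2 else 0 := by
        ext j
        rw [show j - (N + 1) = (j - N) - 1 by ring, st_sub]
        by_cases hj : j = N + 1
        · simp [hj]
        · rw [if_neg (by omega), if_neg hj, mul_zero]
      rw [this]; exact hasSum_ite_eq _ _
    constructor
    · intro hN
      exact hs_congr (hN.add h1) (fun j => by ring) (by push_cast; ring)
    · intro hN
      exact hs_congr (hN.sub h1) (fun j => by ring) (by push_cast; ring)

lemma hasSum_h {y p : ℂ} (hy : y ≠ 0) (hp0 : p ≠ 0) (hp : ‖p‖ < 1)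
    (hyp : ∀ n : ℤ, 0 < n → y * p ^ n ≠ 1) (N : ℤ) : HasSum (fun j : ℤ => h y p j - h y p (j - N)) (N:ℂ) := by
  have hs := summable_e 0 hy hp0 hp hyp
  simp only [pow_zero, one_mul] at hs
  have h1 := hs.hasSum
  have h2 := (Equiv.subRight N).hasSum_iff.2 h1
  refine hs_congr ((hasSum_st N).add (h1.sub h2)) (fun j => ?_) (by ring)
  simp only [h_eq y p, Function.comp, Equiv.subRight_apply]; ring

lemma hasSum_h2 {p : ℂ} (hp0 : p ≠ 0) (hp : ‖p‖ < 1)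
    (hyp : ∀ n : ℤ, 0 < n → 1 * p ^ n ≠ 1) (N : ℤ) :
    HasSum (fun j : ℤ => (j:ℂ) * (N - j) * (h 1 p j - h 1 p (j - N)))
      ((N:ℂ) * ((N^2 - 1) / 6 + 2 * ∑' j : ℤ, (j:ℂ) * e 1 p j)) := by
  have h1 := (summable_e 1 one_ne_zero hp0 hp hyp).hasSum
  simp only [pow_one] at h1
  have h2 := (summable_e 2 one_ne_zero hp0 hp hyp).hasSum
  have h1' := (Equiv.subRight N).hasSum_iff.2 h1
  have h2' := (Equiv.subRight N).hasSum_iff.2 h2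
  have := ((hasSum_st1 N).mul_left (N:ℂ)).sub (hasSum_st2 N)
  refine hs_congr (this.add (((h1.mul_left (N:ℂ)).sub h2).add ((h1'.mul_left (N:ℂ)).add h2')))
    (fun j => ?_) (by ring)
  simp only [h_eq 1 p, Function.comp, Equiv.subRight_apply]; push_cast; ring

lemma one_sub_ne {p : ℂ} (hp0 : p ≠ 0) (hp : ‖p‖ < 1) {N : ℤ} (hN : N ≠ 0) : p ^ N ≠ 1 := by
  intro h
  have h2 : ‖p‖ ^ N = 1 := by rw [← norm_zpow, h, norm_one]
  have hp' : 0 < ‖p‖ := norm_pos_iff.2 hp0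
  rcases (zpow_eq_one_iff_right₀ hp'.le hp.ne).1 h2 with h3
  exact hN h3

end RF6

namespace RF6
open Filter Topology

lemma h_mul {w p : ℂ} (hw : w ≠ 0) (hp0 : p ≠ 0) {N j : ℤ} (h1 : w * p ^ j ≠ 1) (h2 : w * p ^ (j - N) ≠ 1)
    (h3 : p ^ N ≠ 1) :
    h w p j * h w⁻¹ p (N - j) = h 1 p N * (h w p j - h w p (j - N)) := by
  have hu : p ^ N ≠ 0 := zpow_ne_zero _ hp0
  have hj : p ^ j ≠ 0 := zpow_ne_zero _ hp0
  have hx : w * p ^ j ≠ 0 := mul_ne_zero hw hj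
  have e1 : w⁻¹ * p ^ (N - j) = p ^ N / (w * p ^ j) := by rw [zpow_sub₀ hp0]; field_simp
  have e2 : w * p ^ (j - N) = (w * p ^ j) / p ^ N := by rw [zpow_sub₀ hp0]; field_simp
  rw [e2] at h2
  unfold h
  rw [e1, e2, one_mul]
  generalize w * p ^ j = x at *
  generalize p ^ N = u at *
  have a1 : 1 - x ≠ 0 := sub_ne_zero.2 h1.symm
  have a2 : 1 - u ≠ 0 := sub_ne_zero.2 h3.symm
  have a3 : u - x ≠ 0 := by
    intro h; apply h2; rw [sub_eq_zero.1 h]; field_simp [hx]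
  have a4 : x - u ≠ 0 := by intro h; apply a3; linear_combination -h
  have b1 : (1 - u / x)⁻¹ = x / (x - u) := by
    rw [show 1 - u / x = (x - u) / x by field_simp, inv_div]
  have b2 : (1 - x / u)⁻¹ = - (u / (x - u)) := by
    rw [show 1 - x / u = (u - x) / u by field_simp, inv_div, ← neg_sub x u, div_neg]
  rw [b1, b2]
  field_simp
  ring

lemma F_mul {w p z : ℂ} (hw : w ≠ 0) (hp0 : p ≠ 0) (hp : ‖p‖ < 1) (hyp : ∀ n : ℤ, w * p ^ n ≠ 1)
    (hz1 : ‖p‖ < ‖z‖) (hz2 : ‖z‖ < 1) :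
    F w p z * F w⁻¹ p z = J 1 p z + ∑' j : ℤ, h w p j * h w⁻¹ p (0 - j) := by
  have hz0 : z ≠ 0 := norm_pos_iff.1 ((norm_pos_iff.2 hp0).trans hz1)
  have s1 := summable_h 0 hw hp0 hp hz1 hz2
  have s2 := summable_h 0 (inv_ne_zero hw) hp0 hp hz1 hz2
  have s3 := (summable_h 1 one_ne_zero hp0 hp hz1 hz2).of_norm
  simp only [pow_zero, one_mul] at s1 s2
  have hc := conv s1 s2
  have : ∀ N : ℤ, ∑' j : ℤ, (h w p j * z ^ j) * (h w⁻¹ p (N - j) * z ^ (N - j)) =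
      (N:ℂ) ^ 1 * h 1 p N * z ^ N + (if N = 0 then ∑' j : ℤ, h w p j * h w⁻¹ p (0 - j) else 0) := by
    intro N
    have e1 : ∀ j : ℤ, (h w p j * z ^ j) * (h w⁻¹ p (N - j) * z ^ (N - j)) =
        z ^ N * (h w p j * h w⁻¹ p (N - j)) := by
      intro j
      rw [show z ^ N = z ^ j * z ^ (N - j) by rw [← zpow_add₀ hz0]; congr 1; ring]; ring
    simp only [e1]
    rw [tsum_mul_left]
    by_cases hN : N = 0
    · simp [hN]
    · rw [if_neg hN, add_zero]
      simp only [fun j => h_mul hw hp0 (hyp j) (hyp (j - N)) (one_sub_ne hp0 hp hN)]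
      rw [tsum_mul_left, (hasSum_h hw hp0 hp (fun n _ => hyp n) N).tsum_eq]; ring
  simp only [this] at hc
  exact hc.unique (s3.hasSum.add (hasSum_ite_eq _ _))

/-- Lambert constant -/
noncomputable def D (p : ℂ) : ℂ := ∑' j : ℤ, (j:ℂ) * e 1 p j

lemma J_sq {p z : ℂ} (hp0 : p ≠ 0) (hp : ‖p‖ < 1)
    (hz1 : ‖p‖ < ‖z‖) (hz2 : ‖z‖ < 1) :
    J 1 p z * J 1 p z = (J 3 p z - J 1 p z) / 6 + 2 * D p * J 1 p z
      + ∑' j : ℤ, (j:ℂ) * (0 - j) * (h 1 p j * h 1 p (0 - j)) := by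
  have hz0 : z ≠ 0 := norm_pos_iff.1 ((norm_pos_iff.2 hp0).trans hz1)
  have s1 := summable_h 1 one_ne_zero hp0 hp hz1 hz2
  have s3 := summable_h 3 one_ne_zero hp0 hp hz1 hz2
  have hc := conv s1 s1
  have : ∀ N : ℤ, ∑' j : ℤ, ((j:ℂ) ^ 1 * h 1 p j * z ^ j) * (((N - j : ℤ):ℂ) ^ 1 * h 1 p (N - j) * z ^ (N - j)) =
      (((N:ℂ) ^ 3 * h 1 p N * z ^ N - (N:ℂ) ^ 1 * h 1 p N * z ^ N) / 6
        + 2 * D p * ((N:ℂ) ^ 1 * h 1 p N * z ^ N))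
        + (if N = 0 then ∑' j : ℤ, (j:ℂ) * (0 - j) * (h 1 p j * h 1 p (0 - j)) else 0) := by
    intro N
    have e1 : ∀ j : ℤ, ((j:ℂ) ^ 1 * h 1 p j * z ^ j) * (((N - j : ℤ):ℂ) ^ 1 * h 1 p (N - j) * z ^ (N - j)) =
        z ^ N * ((j:ℂ) * (N - j) * (h 1 p j * h 1 p (N - j))) := by
      intro j
      rw [show z ^ N = z ^ j * z ^ (N - j) by rw [← zpow_add₀ hz0]; congr 1; ring]; push_cast; ring
    simp only [e1]
    rw [tsum_mul_left]
    by_cases hN : N = 0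
    · simp [hN]
    · rw [if_neg hN, add_zero]
      have e2 : ∀ j : ℤ, (j:ℂ) * (N - j) * (h 1 p j * h 1 p (N - j)) =
          h 1 p N * ((j:ℂ) * (N - j) * (h 1 p j - h 1 p (j - N))) := by
        intro j
        by_cases hj : j = 0
        · simp [hj]
        by_cases hj2 : j = N
        · simp [hj2]
        have := h_mul (w := 1) one_ne_zero hp0 (N := N) (j := j) (by rw [one_mul]; exact one_sub_ne hp0 hp hj)
          (by rw [one_mul]; exact one_sub_ne hp0 hp (sub_ne_zero.2 hj2)) (one_sub_ne hp0 hp hN)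
        rw [inv_one] at this
        rw [this]; ring
      simp only [e2]
      rw [tsum_mul_left, (hasSum_h2 hp0 hp
        (fun n hn => by rw [one_mul]; exact one_sub_ne hp0 hp hn.ne') N).tsum_eq]
      unfold D; ring
  simp only [this] at hc
  exact hc.unique ((((s3.of_norm.hasSum.sub s1.of_norm.hasSum).div_const 6).add
    (s1.of_norm.hasSum.mul_left (2 * D p))).add (hasSum_ite_eq _ _))

lemma J_three {p z w : ℂ} (hp0 : p ≠ 0) (hp : ‖p‖ < 1)
    (hz1 : ‖p‖ < ‖z‖) (hz2 : ‖z‖ < 1) (hw1 : ‖p‖ < ‖w‖) (hw2 : ‖w‖ < 1) :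
    J 3 p z - J 3 p w = (J 1 p z - J 1 p w) * (6 * (J 1 p z + J 1 p w) + 1 - 12 * D p) := by
  linear_combination -6 * J_sq hp0 hp hz1 hz2 + 6 * J_sq hp0 hp hw1 hw2

lemma P_cont {p : ℂ} (hp : ‖p‖ < 1) (z : ℂ) : Tendsto (fun w => P w p) (𝓝 z) (𝓝 (P z p)) := by
  have h1 : ∀ w, P w p = ∏' n : ℕ, (1 + (- w * p ^ n)) := by
    intro w; unfold P; congr 1; ext n; ring
  simp only [h1]
  have hb : Summable fun n : ℕ => (‖z‖ + 1) * ‖p‖ ^ n :=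
    (summable_geometric_of_lt_one (norm_nonneg _) hp).mul_left _
  refine tendsto_tprod_one_add_of_dominated_convergence hb (fun n => ?_) ?_
  · exact ((continuous_id.neg).mul continuous_const).tendsto z
  · have : ∀ᶠ w in 𝓝 z, ‖w‖ < ‖z‖ + 1 := continuous_norm.tendsto z |>.eventually_lt_const (by linarith)
    filter_upwards [this] with w hw n
    rw [norm_mul, norm_neg, norm_pow]; gcongr

lemma theta_cont {r : ℂ} (hr0 : r ≠ 0) (hr : ‖r‖ < 1) {z : ℂ} (hz : z ≠ 0) :
    Tendsto (theta r) (𝓝 z) (𝓝 (theta r z)) := by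
  have h2 : Tendsto (fun z => P (r^2) (r^2) * P z (r^2) * P (r^2/z) (r^2)) (𝓝 z)
      (𝓝 (P (r^2) (r^2) * P z (r^2) * P (r^2/z) (r^2))) := by
    refine (tendsto_const_nhds.mul (P_cont (norm_sq_lt hr) z)).mul ?_
    exact (P_cont (norm_sq_lt hr) (r^2/z)).comp (tendsto_const_nhds.div tendsto_id hz)
  rw [jtp hr0 hr hz]
  refine h2.congr' ?_
  filter_upwards [isOpen_ne.mem_nhds hz] with w hw
  rw [jtp hr0 hr hw]

end RF6

namespace RF6
open Filter Topology

lemma hdiff_est {y p : ℂ} (hy : y ≠ 0) (hp0 : p ≠ 0) (hp : ‖p‖ < 1) (hyp : ∀ n : ℤ, y * p ^ n ≠ 1) :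
    ∃ C, 0 < C ∧ ∀ k, ‖h y p k - h y p (k - 1)‖ ≤ C * ‖p‖ ^ k.natAbs := by
  obtain ⟨C, hC, hb⟩ := e_est hy hp0 hp (fun n _ => hyp n)
  have hp' : 0 < ‖p‖ := norm_pos_iff.2 hp0
  refine ⟨C + C / ‖p‖ + 1 / ‖p‖, by positivity, fun k => ?_⟩
  have e1 : h y p k - h y p (k - 1) = (st k - st (k - 1)) + (e y p k - e y p (k - 1)) := by
    rw [h_eq, h_eq]; ring
  rw [e1, st_sub]
  have b1 : ‖(if k = 1 then (1:ℂ) else 0)‖ ≤ 1 / ‖p‖ * ‖p‖ ^ k.natAbs := by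
    split_ifs with hk
    · simp [hk, hp'.ne']
    · simp; positivity
  have b2 : ‖e y p (k - 1)‖ ≤ C / ‖p‖ * ‖p‖ ^ k.natAbs := by
    refine (hb (k - 1)).trans ?_
    have : ‖p‖ ^ ((k - 1).natAbs + 1) ≤ ‖p‖ ^ k.natAbs :=
      pow_le_pow_of_le_one hp'.le hp.le (by omega)
    rw [div_mul_eq_mul_div, le_div_iff₀ hp', mul_assoc, ← pow_succ]
    gcongr
  calc _ ≤ ‖(if k = 1 then (1:ℂ) else 0)‖ + (‖e y p k‖ + ‖e y p (k - 1)‖) :=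
        (norm_add_le _ _).trans (by gcongr; exact norm_sub_le _ _)
    _ ≤ 1 / ‖p‖ * ‖p‖ ^ k.natAbs + (C * ‖p‖ ^ k.natAbs + C / ‖p‖ * ‖p‖ ^ k.natAbs) := by
        gcongr; exact hb k
    _ = _ := by ring

lemma F_tele {y p z : ℂ} (hy : y ≠ 0) (hp0 : p ≠ 0) (hp : ‖p‖ < 1) (hz1 : ‖p‖ < ‖z‖) (hz2 : ‖z‖ < 1) :
    (1 - z) * F y p z = ∑' k : ℤ, (h y p k - h y p (k - 1)) * z ^ k := by
  have hz0 : z ≠ 0 := norm_pos_iff.1 ((norm_pos_iff.2 hp0).trans hz1)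
  have hs := (summable_h 0 hy hp0 hp hz1 hz2).of_norm
  simp only [pow_zero, one_mul] at hs
  have h1 := hs.hasSum
  have h2 := (Equiv.subRight (1:ℤ)).hasSum_iff.2 h1
  refine (hs_congr (h1.sub (h2.mul_left z)) (fun j => ?_) ?_).tsum_eq.symm
  · simp only [Function.comp, Equiv.subRight_apply]
    rw [zpow_sub_one₀ hz0]; field_simp
  · unfold F; ring

lemma F_lim {y p : ℂ} (hy : y ≠ 0) (hp0 : p ≠ 0) (hp : ‖p‖ < 1) (hyp : ∀ n : ℤ, y * p ^ n ≠ 1) :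
    Tendsto (fun t : ℝ => (1 - (t:ℂ)) * F y p t) (𝓝[<] 1) (𝓝 1) := by
  obtain ⟨C, hC, hb⟩ := hdiff_est hy hp0 hp hyp
  have hp' : 0 < ‖p‖ := norm_pos_iff.2 hp0
  set ρ := (1 + ‖p‖) / 2 with hρ
  have hρ0 : 0 < ρ := by positivity
  have hρ1 : ρ < 1 := by linarith
  have hρ2 : ‖p‖ < ρ := by linarith
  have hev : ∀ᶠ t : ℝ in 𝓝[<] 1, ρ < t ∧ t < 1 := Ioo_mem_nhdsLT hρ1
  have hlim : Tendsto (fun t : ℝ => ∑' k : ℤ, (h y p k - h y p (k - 1)) * (t:ℂ) ^ k) (𝓝[<] 1)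
      (𝓝 (∑' k : ℤ, (h y p k - h y p (k - 1)))) := by
    have hx1 : ‖p‖ / ρ < 1 := (div_lt_one hρ0).2 hρ2
    have hbs := ((summable_abs 0 (by positivity : 0 ≤ ‖p‖ / ρ) hx1).mul_left C)
    simp only [pow_zero, one_mul] at hbs
    refine tendsto_tsum_of_dominated_convergence hbs (fun k => ?_) ?_
    · have : Tendsto (fun t : ℝ => (t:ℂ) ^ k) (𝓝[<] 1) (𝓝 (1 ^ k)) := by
        have h0 : Tendsto (fun t : ℝ => (t:ℂ)) (𝓝[<] 1) (𝓝 1) := by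
          have := (Complex.continuous_ofReal.tendsto 1)
          rw [Complex.ofReal_one] at this
          exact this.mono_left nhdsWithin_le_nhds
        exact h0.zpow₀ k (Or.inl one_ne_zero)
      have := this.const_mul (h y p k - h y p (k - 1))
      rwa [one_zpow, mul_one] at this
    · filter_upwards [hev] with t ⟨ht1, ht2⟩ k
      have ht0 : 0 < t := hρ0.trans ht1
      rw [norm_mul, norm_zpow, Complex.norm_real, Real.norm_of_nonneg ht0.le, div_pow]
      have : t ^ k ≤ 1 / ρ ^ k.natAbs := by
        rcases le_total 0 k with hk | hk
        · lift k to ℕ using hk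
          rw [Int.natAbs_natCast, zpow_natCast]
          calc t ^ k ≤ 1 := pow_le_one₀ ht0.le ht2.le
            _ ≤ 1 / ρ ^ k := by
              rw [le_div_iff₀ (by positivity), one_mul]; exact pow_le_one₀ hρ0.le hρ1.le
        · obtain ⟨m, rfl⟩ := Int.exists_eq_neg_ofNat hk
          rw [Int.natAbs_neg, Int.natAbs_natCast, zpow_neg, zpow_natCast, ← one_div]
          gcongr
      calc _ ≤ (C * ‖p‖ ^ k.natAbs) * (1 / ρ ^ k.natAbs) := by gcongr; exact hb k
        _ = _ := by ring
  have := hasSum_h hy hp0 hp (fun n _ => hyp n) 1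
  rw [this.tsum_eq] at hlim
  rw [Int.cast_one] at hlim
  refine hlim.congr' ?_
  filter_upwards [hev] with t ⟨ht1, ht2⟩
  have : ‖(t:ℂ)‖ = t := by rw [Complex.norm_real, Real.norm_of_nonneg (hρ0.trans ht1).le]
  rw [F_tele hy hp0 hp (by rw [this]; linarith) (by rw [this]; exact ht2)]

lemma R_theta {r y : ℂ} (hr0 : r ≠ 0) (hr : ‖r‖ < 1) (hy : y ≠ 0) (hyp : ∀ n : ℤ, y * (r^2)^n ≠ 1) :
    R r y * theta r y = P (r^2) (r^2) ^ 3 := by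
  have hp := norm_sq_lt hr
  have hp0 : r^2 ≠ 0 := pow_ne_zero 2 hr0
  have hp' : 0 < ‖r^2‖ := norm_pos_iff.2 hp0
  have hev : ∀ᶠ t : ℝ in 𝓝[<] 1, ‖r^2‖ < t ∧ t < 1 := Ioo_mem_nhdsLT hp
  have h0 : Tendsto (fun t : ℝ => (t:ℂ)) (𝓝[<] 1) (𝓝 1) := by
    have := (Complex.continuous_ofReal.tendsto 1)
    rw [Complex.ofReal_one] at this
    exact this.mono_left nhdsWithin_le_nhds
  have l1 : Tendsto (fun t : ℝ => R r y * theta r (y * t)) (𝓝[<] 1) (𝓝 (R r y * theta r y)) := by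
    refine tendsto_const_nhds.mul ((theta_cont hr0 hr hy).comp ?_)
    have := h0.const_mul y
    rwa [mul_one] at this
  have l2 : Tendsto (fun t : ℝ => ((1 - (t:ℂ)) * F y (r^2) t) * (P (r^2) (r^2) * P (t * r^2) (r^2) * P (r^2 / t) (r^2)))
      (𝓝[<] 1) (𝓝 (1 * (P (r^2) (r^2) * P (r^2) (r^2) * P (r^2) (r^2)))) := by
    refine (F_lim hy hp0 hp hyp).mul ((tendsto_const_nhds.mul ?_).mul ?_)
    · refine (P_cont hp _).comp ?_
      have := h0.mul_const (r^2)
      rwa [one_mul] at this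
    · refine (P_cont hp _).comp ?_
      have := (tendsto_const_nhds (x := r^2)).div h0 one_ne_zero
      rwa [div_one] at this
  have l3 : Tendsto (fun t : ℝ => R r y * theta r (y * t)) (𝓝[<] 1)
      (𝓝 (1 * (P (r^2) (r^2) * P (r^2) (r^2) * P (r^2) (r^2)))) := by
    refine l2.congr' ?_
    filter_upwards [hev] with t ⟨ht1, ht2⟩
    have ht0 : 0 < t := hp'.trans ht1
    have hn : ‖(t:ℂ)‖ = t := by rw [Complex.norm_real, Real.norm_of_nonneg ht0.le]
    have htc : (t:ℂ) ≠ 0 := by exact_mod_cast ht0.ne'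
    rw [← F_theta hr0 hr hy hyp (by rw [hn]; exact ht1) (by rw [hn]; exact ht2), jtp hr0 hr htc,
      P_shift (t:ℂ) hp]
    ring
  rw [tendsto_nhds_unique l1 l3]; ring

lemma ann_ne {p w : ℂ} (hp0 : p ≠ 0) (hp : ‖p‖ < 1) (hw1 : ‖p‖ < ‖w‖) (hw2 : ‖w‖ < 1) (n : ℤ) :
    w * p ^ n ≠ 1 := by
  intro h
  have h2 : ‖w‖ * ‖p‖ ^ n = 1 := by rw [← norm_zpow, ← norm_mul, h, norm_one]
  have hp' : 0 < ‖p‖ := norm_pos_iff.2 hp0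
  rcases le_or_gt 0 n with hn | hn
  · have : ‖p‖ ^ n ≤ 1 := zpow_le_one₀ hp' hp.le hn
    nlinarith [norm_nonneg w]
  · have h3 : ‖p‖ ^ (n + 1) ≥ 1 := by
      obtain ⟨m, hm⟩ := Int.exists_eq_neg_ofNat (by omega : n + 1 ≤ 0)
      rw [hm, zpow_neg, zpow_natCast]
      exact (one_le_inv₀ (by positivity)).2 (pow_le_one₀ hp'.le hp.le)
    rw [zpow_add_one₀ hp'.ne'] at h3
    have : 0 < ‖p‖ ^ n := by positivity
    nlinarith

lemma theta_ne {r w : ℂ} (hr0 : r ≠ 0) (hr : ‖r‖ < 1) (hw1 : ‖r^2‖ < ‖w‖) (hw2 : ‖w‖ < 1) :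
    theta r w ≠ 0 := by
  have hp := norm_sq_lt hr
  have hw' : 0 < ‖w‖ := (norm_nonneg _).trans_lt hw1
  rw [jtp hr0 hr (norm_pos_iff.1 hw')]
  refine mul_ne_zero (mul_ne_zero (P_ne_zero' hp hp) (P_ne_zero' hp hw2)) (P_ne_zero' hp ?_)
  rw [norm_div]; exact (div_lt_one hw').2 hw1

lemma master {r z w : ℂ} (hr0 : r ≠ 0) (hr : ‖r‖ < 1)
    (hz1 : ‖r^2‖ < ‖z‖) (hz2 : ‖z‖ < 1) (hw1 : ‖r^2‖ < ‖w‖) (hw2 : ‖w‖ < 1) :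
    (J 1 (r^2) z - J 1 (r^2) w) * (theta r z ^ 2 * theta r w ^ 2) =
      - w * P (r^2) (r^2) ^ 6 * (theta r (w * z) * theta r (w⁻¹ * z)) := by
  have hp := norm_sq_lt hr
  have hp0 : r^2 ≠ 0 := pow_ne_zero 2 hr0
  have hw0 : w ≠ 0 := norm_pos_iff.1 ((norm_nonneg _).trans_lt hw1)
  have hyp := ann_ne hp0 hp hw1 hw2
  have hyp' : ∀ n : ℤ, w⁻¹ * (r^2)^n ≠ 1 := by
    intro n hn
    apply hyp (-n)
    rw [zpow_neg, ← inv_inv (w * _), mul_inv, inv_inv, hn, inv_one]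
  set K := ∑' j : ℤ, h w (r^2) j * h w⁻¹ (r^2) (0 - j)
  have key : ∀ x : ℂ, ‖r^2‖ < ‖x‖ → ‖x‖ < 1 →
      (J 1 (r^2) x + K) * theta r x ^ 2 = - w * R r w ^ 2 * (theta r (w * x) * theta r (w⁻¹ * x)) := by
    intro x h1 h2
    rw [← F_mul hw0 hp0 hp hyp h1 h2]
    have a1 := F_theta hr0 hr hw0 hyp h1 h2
    have a2 := F_theta hr0 hr (inv_ne_zero hw0) hyp' h1 h2
    rw [R_inv hr0 hw0] at a2
    calc _ = (F w (r^2) x * theta r x) * (F w⁻¹ (r^2) x * theta r x) := by ring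
      _ = _ := by rw [a1, a2]; ring
  have k1 := key w hw1 hw2
  rw [inv_mul_cancel₀ hw0, theta_one hr0 hr, mul_zero, mul_zero] at k1
  have k2 : K = - J 1 (r^2) w := by
    rcases mul_eq_zero.1 k1 with h | h
    · linear_combination h
    · exact absurd h (pow_ne_zero 2 (theta_ne hr0 hr hw1 hw2))
  have k3 := key z hz1 hz2
  have k4 := R_theta hr0 hr hw0 hyp
  rw [k2] at k3
  calc _ = ((J 1 (r^2) z + -J 1 (r^2) w) * theta r z ^ 2) * theta r w ^ 2 := by ring
    _ = - w * (R r w * theta r w) ^ 2 * (theta r (w * z) * theta r (w⁻¹ * z)) := by rw [k3]; ring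
    _ = _ := by rw [k4]; ring

end RF6

namespace RF6
open Filter Topology

lemma inv_one_sub_le {q : ℂ} (hq : ‖q‖ < 1) {b : ℕ} (hb : b ≠ 0) (n : ℕ) :
    ‖(1 - (q^n)^b)⁻¹‖ ≤ (1 - ‖q‖)⁻¹ := by
  have h1 : 0 < 1 - ‖q‖ := by linarith
  rcases Nat.eq_zero_or_pos n with rfl | hn
  · simpa using h1.le
  rw [norm_inv]
  gcongr
  have h2 : ‖(q^n)^b‖ ≤ ‖q‖ := by
    rw [← pow_mul, norm_pow]
    exact pow_le_of_le_one (norm_nonneg _) hq.le (by positivity)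
  have := norm_sub_norm_le (1:ℂ) ((q^n)^b)
  rw [norm_one] at this
  linarith

lemma summable_L {q : ℂ} (hq : ‖q‖ < 1) {c : ℕ → ℂ} {m : ℕ} {C : ℝ} (hc : ∀ n, ‖c n‖ ≤ C * (n:ℝ)^m) {a b : ℕ}
    (ha : a ≠ 0) (hb : b ≠ 0) : Summable fun n : ℕ => c n * ((q^n)^a / (1 - (q^n)^b)) := by
  have h1 : 0 < 1 - ‖q‖ := by linarith
  refine ((summable_pow_geom m (norm_nonneg q) hq).mul_left (C * (1 - ‖q‖)⁻¹)).of_norm_bounded fun n => ?_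
  rw [norm_mul, div_eq_mul_inv, norm_mul]
  have h2 : ‖(q^n)^a‖ ≤ ‖q‖^n := by
    rw [← pow_mul, norm_pow]
    exact pow_le_pow_of_le_one (norm_nonneg _) hq.le (Nat.le_mul_of_pos_right _ (Nat.pos_of_ne_zero ha))
  calc _ ≤ (C * (n:ℝ)^m) * (‖q‖^n * (1 - ‖q‖)⁻¹) := by
        gcongr
        · exact (norm_nonneg _).trans (hc n)
        · exact hc n
        · exact inv_one_sub_le hq hb n
    _ = _ := by ring

/-- `∑ n q^n/(1-q^n)` -/
noncomputable def S (q : ℂ) : ℂ := ∑' n : ℕ, (n:ℂ) * (q^n / (1 - q^n))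

/-- `∑ n u^n q^n/(1-q^(2n))` -/
noncomputable def Lam (u q : ℂ) : ℂ := ∑' n : ℕ, (n:ℂ) * u^n * (q^n / (1 - (q^n)^2))

/-- `∑ n^3 (x-x^3-x^5+x^7)/(1-x^8)` -/
noncomputable def LA (q : ℂ) : ℂ := ∑' n : ℕ, (n:ℂ)^3 * ((q^n - (q^n)^3 - (q^n)^5 + (q^n)^7) / (1 - (q^n)^8))

/-- the character mod 8 -/
noncomputable def chi (n : ℕ) : ℂ := ((ZMod.χ₈ (n : ZMod 8) : ℤ) : ℂ)

/-- `∑ n^3 χ(n) q^n/(1-q^n)` -/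
noncomputable def LB (q : ℂ) : ℂ := ∑' n : ℕ, (n:ℂ)^3 * chi n * (q^n / (1 - q^n))

lemma pow_ne_one' {q : ℂ} (hq : ‖q‖ < 1) {n : ℕ} (hn : n ≠ 0) : q ^ n ≠ 1 := by
  intro h
  have : ‖q‖^n = 1 := by rw [← norm_pow, h, norm_one]
  have h2 := pow_lt_one₀ (norm_nonneg q) hq hn
  linarith

lemma norm_pow_lt {q : ℂ} (hq : ‖q‖ < 1) {n : ℕ} (hn : n ≠ 0) : ‖q^n‖ < 1 := by
  rw [norm_pow]; exact pow_lt_one₀ (norm_nonneg q) hq hn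

lemma tsum_int {f : ℤ → ℂ} (hs : Summable f) (h0 : f 0 = 0) :
    ∑' k, f k = ∑' n : ℕ, (f (n:ℤ) + f (-(n:ℤ))) := by
  have s1 : Summable fun n : ℕ => f n := hs.comp_injective Nat.cast_injective
  have s2 : Summable fun n : ℕ => f (-(n:ℤ)) :=
    hs.comp_injective (i := fun n : ℕ => -(n:ℤ)) (fun a b h => by simpa using h)
  have := (HasSum.of_nat_of_neg s1.hasSum s2.hasSum)
  rw [this.tsum_eq, s1.tsum_add s2, h0, sub_zero]

lemma inv_aux {x : ℂ} (hx : x ≠ 0) : (1 - x⁻¹)⁻¹ = - (x / (1 - x)) := by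
  rw [show 1 - x⁻¹ = - ((1 - x) / x) by field_simp; ring, inv_neg, inv_div]

lemma J_nat {m : ℕ} (hm : Odd m) {p z : ℂ} (hp0 : p ≠ 0) (hp : ‖p‖ < 1) (hz1 : ‖p‖ < ‖z‖) (hz2 : ‖z‖ < 1) :
    J m p z = ∑' n : ℕ, (n:ℂ)^m * ((z^n + (p/z)^n) / (1 - p^n)) := by
  have hz0 : z ≠ 0 := norm_pos_iff.1 ((norm_pos_iff.2 hp0).trans hz1)
  have hs := (summable_h m one_ne_zero hp0 hp hz1 hz2).of_norm
  have hm0 : m ≠ 0 := by rintro rfl; simp at hm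
  unfold J
  rw [tsum_int hs (by simp [zero_pow hm0])]
  congr 1; ext n
  simp only [Int.cast_neg, Int.cast_natCast, hm.neg_pow, h, one_mul, zpow_neg, zpow_natCast, div_pow]
  rcases Nat.eq_zero_or_pos n with rfl | hn
  · simp [zero_pow hm0]
  have h1 : 1 - p^n ≠ 0 := sub_ne_zero.2 (pow_ne_one' hp hn.ne').symm
  have h2 : p^n ≠ 0 := pow_ne_zero _ hp0
  have h3 := inv_aux h2
  rw [h3]
  field_simp

lemma D_eq {p : ℂ} (hp0 : p ≠ 0) (hp : ‖p‖ < 1) : D p = 2 * S p := by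
  have hs := summable_e 1 one_ne_zero hp0 hp (fun n hn => by rw [one_mul]; exact one_sub_ne hp0 hp hn.ne')
  simp only [pow_one] at hs
  unfold D S
  rw [tsum_int hs (by simp), ← tsum_mul_left]
  congr 1; ext n
  rcases Nat.eq_zero_or_pos n with rfl | hn
  · simp
  have h1 : 1 - p^n ≠ 0 := sub_ne_zero.2 (pow_ne_one' hp hn.ne').symm
  have h2 : p^n ≠ 0 := pow_ne_zero _ hp0
  have h3 := inv_aux h2
  simp only [Int.cast_neg, Int.cast_natCast, e, h, st, one_mul, zpow_neg, zpow_natCast, h3]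
  rw [if_pos (by omega), if_neg (by omega)]
  field_simp
  ring

lemma norm_n {n : ℕ} (m : ℕ) : ‖(n:ℂ)^m‖ = (n:ℝ)^m := by simp

lemma summable_S {q : ℂ} (hq : ‖q‖ < 1) : Summable fun n : ℕ => (n:ℂ) * (q^n / (1 - q^n)) := by
  simpa using summable_L hq (c := fun n => (n:ℂ)) (m := 1) (C := 1) (by simp) one_ne_zero one_ne_zero

lemma summable_Lam {u q : ℂ} (hu : ‖u‖ = 1) (hq : ‖q‖ < 1) :
    Summable fun n : ℕ => (n:ℂ) * u^n * (q^n / (1 - (q^n)^2)) := by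
  simpa using summable_L hq (c := fun n => (n:ℂ) * u^n) (m := 1) (C := 1) (by simp [hu]) one_ne_zero two_ne_zero

lemma Lam_one {q : ℂ} (hq : ‖q‖ < 1) : Lam 1 q = S q - S (q^2) := by
  unfold Lam S
  rw [← (summable_S hq).tsum_sub (summable_S (norm_pow_lt hq two_ne_zero))]
  congr 1; ext n
  rcases Nat.eq_zero_or_pos n with rfl | hn
  · simp
  have h1 : 1 - q^n ≠ 0 := sub_ne_zero.2 (pow_ne_one' hq hn.ne').symm
  have h2 : 1 - (q^n)^2 ≠ 0 := by
    rw [← pow_mul]; exact sub_ne_zero.2 (pow_ne_one' hq (by positivity)).symm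
  rw [← pow_mul q 2 n, mul_comm 2 n, pow_mul, one_pow, mul_one]
  generalize q^n = x at *
  field_simp
  ring

lemma tsum_even' {f : ℕ → ℂ} (hf : ∀ n, Odd n → f n = 0) : ∑' n, f n = ∑' n, f (2 * n) := by
  refine (Function.Injective.tsum_eq (g := fun n : ℕ => 2 * n) (fun a b h => by simpa using h) ?_).symm
  intro n hn
  rcases Nat.even_or_odd n with h | h
  · obtain ⟨k, hk⟩ := h
    exact ⟨k, by simp; omega⟩
  · exact absurd (hf n h) hn

lemma Lam_neg {u q : ℂ} (hu : ‖u‖ = 1) (hq : ‖q‖ < 1) : Lam u q + Lam (-u) q = 4 * Lam (u^2) (q^2) := by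
  unfold Lam
  rw [← (summable_Lam hu hq).tsum_add (summable_Lam (by rwa [norm_neg]) hq), tsum_even', ← tsum_mul_left]
  · congr 1; ext n
    rw [(even_two_mul n).neg_pow]
    simp only [pow_mul]
    push_cast; ring
  · intro n hn
    rw [hn.neg_pow]; ring

end RF6

namespace RF6
open Filter Topology

/-- Euler product -/
noncomputable def E (x : ℂ) : ℂ := P x x

lemma E_ne {x : ℂ} (hx : ‖x‖ < 1) : E x ≠ 0 := P_ne_zero' hx hx

lemma Po_eq {x : ℂ} (hx : ‖x‖ < 1) : P x (x^2) = E x / E (x^2) := by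
  rw [eq_div_iff (E_ne (norm_sq_lt hx))]
  unfold E
  rw [P_split x hx, ← sq]

lemma Pn_eq {x : ℂ} (hx : ‖x‖ < 1) : P (-x) x = E (x^2) / E x := by
  rw [eq_div_iff (E_ne hx), mul_comm]
  exact P_sq x hx

lemma Pno_eq {x : ℂ} (hx : ‖x‖ < 1) : P (-x) (x^2) = E (x^2)^2 / (E x * E (x^4)) := by
  have h2 := norm_sq_lt hx
  have h := P_sq x h2
  rw [Po_eq hx, Po_eq h2, ← pow_mul] at h
  have n1 := E_ne hx
  have n2 := E_ne h2
  have n4 := E_ne (norm_pow_lt hx (n := 4) (by norm_num))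
  norm_num at h
  field_simp at h ⊢
  linear_combination h

/-- theta function -/
noncomputable def Phi (q : ℂ) : ℂ := ∑' n : ℤ, q ^ (n^2)

lemma neg_one_zpow_sq (n : ℤ) : ((-1:ℂ))^n * (-1)^n = 1 := by
  rw [← mul_zpow]; norm_num

lemma Phi_theta {q : ℂ} (hq0 : q ≠ 0) : Phi q = theta q (-q) := by
  unfold Phi theta
  congr 1; ext n
  rw [show (-q)^n = (-1)^n * q^n by rw [← mul_zpow]; simp, show n^2 = n^2 - n + n by ring, zpow_add₀ hq0]
  have := neg_one_zpow_sq n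
  rw [show n^2 - n + n - n = n^2 - n by ring]
  linear_combination (- q ^ (n ^ 2 - n) * q ^ n) * this

lemma summable_Phi {q : ℂ} (hq0 : q ≠ 0) (hq : ‖q‖ < 1) : Summable fun n : ℤ => ‖q ^ (n^2)‖ := by
  refine (summable_theta_norm hq0 hq (neg_ne_zero.2 hq0)).congr fun n => ?_
  congr 1
  rw [show (-q)^n = (-1)^n * q^n by rw [← mul_zpow]; simp, show n^2 = n^2 - n + n by ring, zpow_add₀ hq0]
  have := neg_one_zpow_sq n
  rw [show n^2 - n + n - n = n^2 - n by ring]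
  linear_combination (q ^ (n ^ 2 - n) * q ^ n) * this

lemma Phi_eq {q : ℂ} (hq0 : q ≠ 0) (hq : ‖q‖ < 1) : Phi q = E (q^2)^5 / (E q^2 * E (q^4)^2) := by
  have e1 : q^2 / (-q) = -q := by field_simp
  rw [Phi_theta hq0, jtp hq0 hq (neg_ne_zero.2 hq0), e1, Pno_eq hq, ← E]
  have n1 := E_ne hq
  have n4 := E_ne (norm_pow_lt hq (n := 4) (by norm_num))
  field_simp

lemma Phi_neg_eq {q : ℂ} (hq0 : q ≠ 0) (hq : ‖q‖ < 1) : Phi (-q) = E q^2 / E (q^2) := by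
  have e1 : (-q)^2 = q^2 := by ring
  have e2 : q^2 / q = q := by field_simp
  rw [Phi_theta (neg_ne_zero.2 hq0), neg_neg, jtp (neg_ne_zero.2 hq0) (by rwa [norm_neg]) hq0, e1, e2, Po_eq hq, ← E]
  have n2 := E_ne (norm_sq_lt hq)
  field_simp

lemma even_odd_int {f : ℤ → ℂ} {a b : ℂ} (he : HasSum (fun k : ℤ => f (2 * k)) a)
    (ho : HasSum (fun k : ℤ => f (2 * k + 1)) b) : HasSum f (a + b) := by
  have i1 : Function.Injective fun k : ℤ => 2 * k := fun a b h => by simpa using h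
  have i2 : Function.Injective fun k : ℤ => 2 * k + 1 := fun a b h => by simpa using h
  have h1 := i1.hasSum_range_iff.2 he
  have h2 := i2.hasSum_range_iff.2 ho
  refine h1.add_isCompl ?_ h2
  have e1 : Set.range (fun k : ℤ => 2 * k) = {n | Even n} := by
    ext n; simp [even_iff_two_dvd, dvd_def, eq_comm]
  have e2 : Set.range (fun k : ℤ => 2 * k + 1) = {n | Odd n} := by
    ext n; simp [Odd, eq_comm]
  rw [e1, e2]; exact Int.isCompl_even_odd

/-- the odd part -/
noncomputable def dd (q : ℂ) : ℂ := q * theta (q^4) (-q^8)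

lemma Phi_split {q : ℂ} (hq0 : q ≠ 0) (hq : ‖q‖ < 1) : Phi q = Phi (q^4) + dd q := by
  have hs := (summable_Phi hq0 hq).of_norm
  have s1 : Summable fun n : ℤ => q ^ ((2 * n)^2) := hs.comp_injective (i := fun n : ℤ => 2 * n)
    (fun a b h => by simpa using h)
  have s2 : Summable fun n : ℤ => q ^ ((2 * n + 1)^2) := hs.comp_injective (i := fun n : ℤ => 2 * n + 1)
    (fun a b h => by simpa using h)
  have h := even_odd_int (f := fun n : ℤ => q ^ (n^2)) s1.hasSum s2.hasSum
  unfold Phi dd theta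
  rw [h.tsum_eq, ← tsum_mul_left]
  congr 1
  · congr 1; ext n
    rw [← zpow_natCast, ← zpow_mul]; congr 1; push_cast; ring
  · congr 1; ext n
    rw [show (-q^8)^n = (-1)^n * (q^8)^n by rw [← mul_zpow]; simp]
    have := neg_one_zpow_sq n
    have e3 : q ^ ((2 * n + 1)^2) = q * ((q^4)^(n^2-n) * (q^8)^n) := by
      rw [← zpow_natCast q 4, ← zpow_natCast q 8, ← zpow_mul, ← zpow_mul, ← zpow_add₀ hq0, ← zpow_one_add₀ hq0]
      congr 1; push_cast; ring
    rw [e3]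
    linear_combination (-q * (q ^ 4) ^ (n ^ 2 - n) * (q ^ 8) ^ n) * this

lemma dd_eq {q : ℂ} (hq0 : q ≠ 0) (hq : ‖q‖ < 1) : dd q = 2 * q * E (q^16)^2 / E (q^8) := by
  have h8 := norm_pow_lt hq (n := 8) (by norm_num)
  have e1 : (q^4)^2 = q^8 := by ring
  have e2 : q^8 / (-q^8) = -1 := by field_simp
  have e3 : (q^8)^2 = q^16 := by ring
  unfold dd
  rw [jtp (pow_ne_zero 4 hq0) (norm_pow_lt hq (by norm_num)) (neg_ne_zero.2 (pow_ne_zero 8 hq0)), e1, e2,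
    P_shift (-1) h8, show -1 * q^8 = -q^8 by ring, Pn_eq h8, ← E, e3]
  have n8 := E_ne h8
  field_simp
  ring

lemma Phi_mul_neg {q : ℂ} (hq0 : q ≠ 0) (hq : ‖q‖ < 1) : Phi q * Phi (-q) = Phi (-q^2)^2 := by
  rw [Phi_eq hq0 hq, Phi_neg_eq hq0 hq, Phi_neg_eq (pow_ne_zero 2 hq0) (norm_sq_lt hq)]
  have n1 := E_ne hq
  have n2 := E_ne (norm_sq_lt hq)
  have n4 := E_ne (norm_pow_lt hq (n := 4) (by norm_num))
  rw [show (q^2)^2 = q^4 by ring]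
  field_simp

lemma Phi_neg_split {q : ℂ} (hq0 : q ≠ 0) (hq : ‖q‖ < 1) : Phi (-q) = Phi (q^4) - dd q := by
  rw [Phi_split (neg_ne_zero.2 hq0) (by rwa [norm_neg])]
  unfold dd
  rw [show (-q)^4 = q^4 by ring, show (-q)^8 = q^8 by ring]; ring

lemma Phi_sq {q : ℂ} (hq0 : q ≠ 0) (hq : ‖q‖ < 1) : Phi (q^2)^2 = Phi (q^4)^2 + dd q^2 := by
  have h0 : Complex.I * q ≠ 0 := mul_ne_zero I_ne_zero hq0
  have h1 : ‖Complex.I * q‖ < 1 := by rwa [norm_mul, Complex.norm_I, one_mul]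
  have h := Phi_mul_neg h0 h1
  rw [Phi_neg_split h0 h1, Phi_split h0 h1] at h
  have i4 : Complex.I^4 = 1 := I_pow_four
  have i2 : Complex.I^2 = -1 := I_sq
  have e4 : (Complex.I * q)^4 = q^4 := by rw [mul_pow, i4, one_mul]
  have e8 : (Complex.I * q)^8 = q^8 := by rw [mul_pow, show Complex.I^8 = (Complex.I^4)^2 by ring, i4, one_pow, one_mul]
  have e2 : -(Complex.I * q)^2 = q^2 := by rw [mul_pow, i2]; ring
  have ed : dd (Complex.I * q) = Complex.I * dd q := by unfold dd; rw [e4, e8]; ring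
  rw [e4, e2, ed] at h
  linear_combination -h - dd q ^ 2 * i2

end RF6

namespace RF6
open Filter Topology

lemma ab_eq {q : ℂ} (hq0 : q ≠ 0) (hq : ‖q‖ < 1) :
    Phi q ^ 2 - Phi (q^2) ^ 2 = 4 * q * E (q^8)^4 / E (q^4)^2 := by
  have h4 := norm_pow_lt hq (n := 4) (by norm_num)
  have h1 : Phi q ^ 2 - Phi (q^2) ^ 2 = 2 * Phi (q^4) * dd q := by
    rw [Phi_split hq0 hq, Phi_sq hq0 hq]; ring
  have n4 := E_ne h4
  have n8 := E_ne (norm_pow_lt hq (n := 8) (by norm_num))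
  have n16 := E_ne (norm_pow_lt hq (n := 16) (by norm_num))
  rw [h1, Phi_eq (pow_ne_zero 4 hq0) h4, dd_eq hq0 hq, show (q^4)^2 = q^8 by ring, show (q^4)^4 = q^16 by ring]
  field_simp
  ring

lemma theta_self {r : ℂ} (hr0 : r ≠ 0) (hr : ‖r‖ < 1) : theta r r = E r^2 / E (r^2) := by
  rw [jtp hr0 hr hr0, show r^2 / r = r by field_simp, Po_eq hr, ← E]
  have := E_ne (norm_sq_lt hr)
  field_simp

lemma theta_neg_one {r : ℂ} (hr0 : r ≠ 0) (hr : ‖r‖ < 1) : theta r (-1) = 2 * E (r^4)^2 / E (r^2) := by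
  have h2 := norm_sq_lt hr
  rw [jtp hr0 hr (by norm_num), P_shift (-1) h2, show -1 * r^2 = - r^2 by ring, show r^2 / (-1) = -r^2 by ring,
    Pn_eq h2, ← E, show (r^2)^2 = r^4 by ring]
  have := E_ne h2
  field_simp
  ring

lemma theta_half {q : ℂ} (hq0 : q ≠ 0) (hq : ‖q‖ < 1) : theta (q^2) q = E (q^4) * P q (q^2) := by
  have h2 := norm_sq_lt hq
  rw [jtp (pow_ne_zero 2 hq0) h2 hq0, P_split q h2, show (q^2)^2 = q^4 by ring,
    show q^4 / q = q * q^2 by field_simp, ← E]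
  ring

lemma J_I1 {q u : ℂ} (hq0 : q ≠ 0) (hq : ‖q‖ < 1) (hu : u * u = 1) (hu1 : ‖u‖ = 1) : J 1 (q^4) (u * q) = Lam u q := by
  have hu0 : u ≠ 0 := by rintro rfl; simp at hu
  have hn : ‖u * q‖ = ‖q‖ := by rw [norm_mul, hu1, one_mul]
  rw [J_nat odd_one (pow_ne_zero 4 hq0) (norm_pow_lt hq (by norm_num)) _ (by rwa [hn])]
  · unfold Lam
    congr 1; ext n
    rcases Nat.eq_zero_or_pos n with rfl | h
    · simp
    have e1 : q^4 / (u * q) = u * q^3 := by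
      field_simp; linear_combination (-1 : ℂ) * hu
    have h1 : 1 - (q^n)^2 ≠ 0 := by
      rw [← pow_mul]; exact sub_ne_zero.2 (pow_ne_one' hq (by positivity)).symm
    have h2 : 1 - (q^n)^4 ≠ 0 := by
      rw [← pow_mul]; exact sub_ne_zero.2 (pow_ne_one' hq (by positivity)).symm
    rw [e1, mul_pow, mul_pow, ← pow_mul q 3, ← pow_mul q 4, mul_comm 3, mul_comm 4, pow_mul, pow_mul]
    generalize q^n = x at *
    field_simp
    ring
  · rw [hn, norm_pow]
    have := norm_pos_iff.2 hq0
    calc ‖q‖^4 = ‖q‖ * ‖q‖^3 := by ring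
      _ < ‖q‖ * 1 := by gcongr; exact pow_lt_one₀ this.le hq (by norm_num)
      _ = _ := mul_one _

lemma norm_pow_lt' {q : ℂ} (hq0 : q ≠ 0) (hq : ‖q‖ < 1) {a b : ℕ} (h : b < a) : ‖q^a‖ < ‖q^b‖ := by
  rw [norm_pow, norm_pow]
  exact pow_lt_pow_right_of_lt_one₀ (norm_pos_iff.2 hq0) hq h

lemma Y_eq {q : ℂ} (hq0 : q ≠ 0) (hq : ‖q‖ < 1) :
    S q - 3 * S (q^2) + 2 * S (q^4) = Phi (q^2) ^ 2 * (Phi q ^ 2 - Phi (q^2)^2) / 4 := by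
  have h2 := norm_sq_lt hq
  have hq02 := pow_ne_zero 2 hq0
  have hm := master (r := q^2) (z := q) (w := -q) hq02 h2
    (by rw [← pow_mul]; simpa using norm_pow_lt' hq0 hq (a := 4) (b := 1) (by norm_num)) hq
    (by rw [← pow_mul, norm_neg]; simpa using norm_pow_lt' hq0 hq (a := 4) (b := 1) (by norm_num))
    (by rwa [norm_neg])
  have t2 : theta (q^2) (-q) = E (q^4) * P (-q) (q^2) := by
    have := theta_half (neg_ne_zero.2 hq0) (by rwa [norm_neg])
    rwa [neg_sq, show (-q)^4 = q^4 by ring] at this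
  have j1 := J_I1 (u := 1) hq0 hq (by norm_num) (by norm_num)
  have j2 := J_I1 (u := -1) hq0 hq (by norm_num) (by norm_num)
  rw [one_mul] at j1
  rw [neg_one_mul] at j2
  have l1 := Lam_neg (u := 1) (by norm_num) hq
  rw [show -q * q = - q^2 by ring, show (-q)⁻¹ * q = -1 by field_simp, ← Phi_theta hq02, theta_neg_one hq02 h2,
    t2, theta_half hq0 hq, Po_eq hq, Pno_eq hq, Phi_eq hq02 h2, show (q^2)^2 = q^4 by ring, j1, j2,
    show (q^2)^4 = q^8 by ring, ← E] at hm
  rw [one_pow, Lam_one hq, Lam_one h2, ← pow_mul] at l1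
  rw [Lam_one hq] at hm
  rw [ab_eq hq0 hq, Phi_eq hq02 h2, show (q^2)^2 = q^4 by ring, show (q^2)^4 = q^8 by ring]
  have n1 := E_ne hq
  have n2 := E_ne h2
  have n4 := E_ne (norm_pow_lt hq (n := 4) (by norm_num))
  have n8 := E_ne (norm_pow_lt hq (n := 8) (by norm_num))
  norm_num at l1
  have l2 : S q - S (q^2) - Lam (-1) q = 2 * (S q - 3 * S (q^2) + 2 * S (q^4)) := by linear_combination -l1
  rw [l2] at hm
  generalize S q - 3 * S (q^2) + 2 * S (q^4) = y at *
  field_simp at hm ⊢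
  linear_combination hm

end RF6

namespace RF6
open Filter Topology

lemma LA_eq {q : ℂ} (hq0 : q ≠ 0) (hq : ‖q‖ < 1) :
    LA q = Phi q * Phi (q^2) * (Phi q ^ 2 - Phi (q^2)^2) / 4 *
      (6 * (S q - S (q^2)) + 1 - 24 * S (q^8)) := by
  have h2 := norm_sq_lt hq
  have hq02 := pow_ne_zero 2 hq0
  have hq04 := pow_ne_zero 4 hq0
  have hq08 := pow_ne_zero 8 hq0
  have h4 := norm_pow_lt hq (n := 4) (by norm_num)
  have h8 := norm_pow_lt hq (n := 8) (by norm_num)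
  have c1 : ‖q^8‖ < ‖q‖ := by simpa using norm_pow_lt' hq0 hq (a := 8) (b := 1) (by norm_num)
  have c2 : ‖q^8‖ < ‖q^3‖ := norm_pow_lt' hq0 hq (by norm_num)
  have c3 : ‖q^3‖ < 1 := norm_pow_lt hq (by norm_num)
  have p8 : (q^4)^2 = q^8 := by ring
  have hm := master (r := q^4) (z := q) (w := q^3) hq04 h4 (by rwa [p8]) hq (by rwa [p8]) c3
  have h3 := J_three hq08 h8 c1 hq c2 c3
  have jn : ∀ m : ℕ, Odd m → J m (q^8) q = ∑' n : ℕ, (n:ℂ)^m * ((q^n + (q^n)^7) / (1 - (q^n)^8)) := by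
    intro m hm
    rw [J_nat hm hq08 h8 c1 hq]
    congr 1; ext n
    rw [show q^8/q = q^7 by field_simp, ← pow_mul q 8, ← pow_mul q 7, mul_comm 8, mul_comm 7, pow_mul, pow_mul]
  have jn3 : ∀ m : ℕ, Odd m → J m (q^8) (q^3) = ∑' n : ℕ, (n:ℂ)^m * (((q^n)^3 + (q^n)^5) / (1 - (q^n)^8)) := by
    intro m hm
    rw [J_nat hm hq08 h8 c2 c3]
    congr 1; ext n
    rw [show q^8/q^3 = q^5 by field_simp, ← pow_mul q 8, ← pow_mul q 5, ← pow_mul q 3, mul_comm 8, mul_comm 5,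
      mul_comm 3, pow_mul, pow_mul, pow_mul]
  have hsum : ∀ m a : ℕ, a ≠ 0 → Summable fun n : ℕ => (n:ℂ)^m * ((q^n)^a / (1 - (q^n)^8)) := fun m a ha =>
    summable_L hq (c := fun n => (n:ℂ)^m) (m := m) (C := 1) (by simp) ha (by norm_num)
  have sa : ∀ m : ℕ, Summable fun n : ℕ => (n:ℂ)^m * ((q^n + (q^n)^7) / (1 - (q^n)^8)) := fun m => by
    refine ((hsum m 1 (by norm_num)).add (hsum m 7 (by norm_num))).congr fun n => ?_
    ring
  have sb : ∀ m : ℕ, Summable fun n : ℕ => (n:ℂ)^m * (((q^n)^3 + (q^n)^5) / (1 - (q^n)^8)) := fun m => by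
    refine ((hsum m 3 (by norm_num)).add (hsum m 5 (by norm_num))).congr fun n => ?_
    ring
  have l1 : J 1 (q^8) q + J 1 (q^8) (q^3) = S q - S (q^2) := by
    rw [← Lam_one hq, jn 1 odd_one, jn3 1 odd_one, ← (sa 1).tsum_add (sb 1)]
    unfold Lam
    congr 1; ext n
    rcases Nat.eq_zero_or_pos n with rfl | h
    · simp
    have d1 : 1 - (q^n)^2 ≠ 0 := by
      rw [← pow_mul]; exact sub_ne_zero.2 (pow_ne_one' hq (by positivity)).symm
    have d2 : 1 - (q^n)^8 ≠ 0 := by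
      rw [← pow_mul]; exact sub_ne_zero.2 (pow_ne_one' hq (by positivity)).symm
    generalize q^n = x at *
    field_simp
    ring
  have l3 : J 3 (q^8) q - J 3 (q^8) (q^3) = LA q := by
    rw [jn 3 (by decide), jn3 3 (by decide), ← (sa 3).tsum_sub (sb 3)]
    unfold LA
    congr 1; ext n
    ring
  rw [l1, l3, D_eq hq08 h8] at h3
  have t12 : theta (q^4) q * theta (q^4) (q^3) = E (q^8)^2 * P q (q^2) := by
    rw [jtp hq04 h4 hq0, jtp hq04 h4 (pow_ne_zero 3 hq0), p8, P_split q h2, show (q^2)^2 = q^4 by ring,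
      P_split q h4, P_split (q * q^2) h4, p8, show q^8/q = q*q^2*q^4 by field_simp,
      show q^8/q^3 = q*q^4 by field_simp, show q*q^2 = q^3 by ring, ← E]
    ring
  have t4 : theta (q^4) ((q^3)⁻¹ * q) = - (E (q^8) * P (q^2) (q^4)) / q^2 := by
    rw [show (q^3)⁻¹ * q = (q^2)⁻¹ by field_simp, theta_inv hq04 h4 hq02]
    have := theta_half hq02 h2
    rw [show (q^2)^2 = q^4 by ring, show (q^2)^4 = q^8 by ring] at this
    rw [this]
  have po2 := Po_eq h2
  rw [show (q^2)^2 = q^4 by ring] at po2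
  have n1 := E_ne hq
  have n2 := E_ne h2
  have n4 := E_ne h4
  have n8 := E_ne h8
  rw [← mul_pow, t12, t4, show q^3 * q = q^4 by ring, theta_self hq04 h4, p8, Po_eq hq, po2, ← E] at hm
  have key : J 1 (q^8) q - J 1 (q^8) (q^3) = Phi q * Phi (q^2) * (Phi q ^ 2 - Phi (q^2)^2) / 4 := by
    rw [ab_eq hq0 hq, Phi_eq hq02 h2, Phi_eq hq0 hq, show (q^2)^2 = q^4 by ring, show (q^2)^4 = q^8 by ring]
    generalize J 1 (q^8) q - J 1 (q^8) (q^3) = y at *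
    field_simp at hm ⊢
    linear_combination hm
  rw [h3, key]; ring

end RF6

namespace RF6
open Filter Topology

lemma chi_mod (n : ℕ) : chi n = chi (n % 8) := by
  unfold chi; rw [ZMod.natCast_mod]

lemma chi_norm (n : ℕ) : ‖chi n‖ ≤ 1 := by
  unfold chi
  have : ∀ a : ZMod 8, ZMod.χ₈ a = 0 ∨ ZMod.χ₈ a = 1 ∨ ZMod.χ₈ a = -1 := by decide
  rcases this (n : ZMod 8) with h | h | h <;> simp [h]

lemma chi_zeta {ζ : ℂ} (hz : ζ^4 = -1) (n : ℕ) :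
    ζ^n + (-ζ^3)^n - (ζ^3)^n - (-ζ)^n = 2 * (ζ - ζ^3) * chi n := by
  have h8 : ∀ u : ℂ, u^8 = 1 → u^n = u^(n % 8) := fun u hu => by
    conv_lhs => rw [← Nat.div_add_mod n 8, pow_add, pow_mul, hu, one_pow, one_mul]
  have z8 : ζ^8 = 1 := by rw [show ζ^8 = (ζ^4)^2 by ring, hz]; norm_num
  rw [h8 ζ z8, h8 (-ζ) (by rw [← z8]; ring), h8 (ζ^3) (by rw [← pow_mul, pow_mul' , z8, one_pow]),
    h8 (-ζ^3) (by rw [show (-ζ^3)^8 = (ζ^8)^3 by ring, z8, one_pow]), chi_mod]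
  have hlt : n % 8 < 8 := Nat.mod_lt _ (by norm_num)
  generalize n % 8 = m at *
  have c0 : ZMod.χ₈ 0 = 0 := by decide
  have c1 : ZMod.χ₈ 1 = 1 := by decide
  have c2 : ZMod.χ₈ 2 = 0 := by decide
  have c3 : ZMod.χ₈ 3 = -1 := by decide
  have c4 : ZMod.χ₈ 4 = 0 := by decide
  have c5 : ZMod.χ₈ 5 = -1 := by decide
  have c6 : ZMod.χ₈ 6 = 0 := by decide
  have c7 : ZMod.χ₈ 7 = 1 := by decide
  interval_cases m <;>
    simp only [chi, Nat.cast_zero, Nat.cast_one, Nat.cast_ofNat, c0, c1, c2, c3, c4, c5, c6, c7] <;> push_cast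
  · ring
  · ring
  · ring
  · linear_combination (-2 * ζ^5 + 2 * ζ) * hz
  · ring
  · linear_combination (-2 * ζ^11 + 2 * ζ^7 + 2 * ζ - 2 * ζ^3) * hz
  · ring
  · linear_combination (-2 * ζ^17 + 2 * ζ^13 + 2 * ζ^3 - 2 * ζ^9 + 2 * ζ^5 - 2 * ζ) * hz

/-- odd part of `LB` -/
noncomputable def LBo (q : ℂ) : ℂ := ∑' n : ℕ, (n:ℂ)^3 * chi n * (q^n / (1 - (q^n)^2))

lemma LB_sub {q : ℂ} (hq : ‖q‖ < 1) : LB q - LB (q^2) = LBo q := by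
  have hs : ∀ q : ℂ, ‖q‖ < 1 → Summable fun n : ℕ => (n:ℂ)^3 * chi n * (q^n / (1 - q^n)) := fun q hq => by
    simpa using summable_L hq (c := fun n => (n:ℂ)^3 * chi n) (m := 3) (C := 1) (fun n => by
      rw [norm_mul, norm_n, one_mul]
      exact mul_le_of_le_one_right (by positivity) (chi_norm n)) one_ne_zero one_ne_zero
  unfold LB LBo
  rw [← (hs q hq).tsum_sub (hs (q^2) (norm_sq_lt hq))]
  congr 1; ext n
  rcases Nat.eq_zero_or_pos n with rfl | hn
  · simp
  have h1 : 1 - q^n ≠ 0 := sub_ne_zero.2 (pow_ne_one' hq hn.ne').symm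
  have h2 : 1 - (q^n)^2 ≠ 0 := by
    rw [← pow_mul]; exact sub_ne_zero.2 (pow_ne_one' hq (by positivity)).symm
  rw [← pow_mul q 2 n, mul_comm 2 n, pow_mul]
  generalize q^n = x at *
  field_simp
  ring

lemma LBo_eq {q : ℂ} (hq0 : q ≠ 0) (hq : ‖q‖ < 1) :
    LBo q = Phi q * Phi (q^2) * Phi (-q) * dd q / 2 *
      (96 * (5 * S (q^8) - 4 * S (q^16) - S (q^4)) + 1 - 24 * S (q^2)) := by
  obtain ⟨ζ, hz⟩ := IsAlgClosed.exists_pow_nat_eq (-1 : ℂ) (n := 4) (by norm_num)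
  have z0 : ζ ≠ 0 := by rintro rfl; norm_num at hz
  have zn : ‖ζ‖ = 1 := by
    have : ‖ζ‖^4 = 1 := by rw [← norm_pow, hz]; simp
    exact (pow_eq_one_iff_of_nonneg (norm_nonneg _) (by norm_num)).1 this
  have zn3 : ‖ζ^3‖ = 1 := by rw [norm_pow, zn, one_pow]
  have s0 : ζ - ζ^3 ≠ 0 := by
    intro h
    have h1 : ζ * (1 - ζ^2) = 0 := by linear_combination h
    rcases mul_eq_zero.1 h1 with h2 | h2
    · exact z0 h2
    · have : ζ^4 = 1 := by linear_combination (-1 - ζ^2) * h2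
      rw [hz] at this; norm_num at this
  have h2 := norm_sq_lt hq
  have hq02 := pow_ne_zero 2 hq0
  have hq04 := pow_ne_zero 4 hq0
  have h4 := norm_pow_lt hq (n := 4) (by norm_num)
  have h8 := norm_pow_lt hq (n := 8) (by norm_num)
  have h16 := norm_pow_lt hq (n := 16) (by norm_num)
  have c0 : ‖q^2‖ < ‖q‖ := by simpa using norm_pow_lt' hq0 hq (a := 2) (b := 1) (by norm_num)
  have c1 : ‖q^2‖ < ‖ζ * q‖ := by rwa [norm_mul, zn, one_mul]
  have c2 : ‖ζ * q‖ < 1 := by rwa [norm_mul, zn, one_mul]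
  have c3 : ‖q^2‖ < ‖ζ^3 * q‖ := by rwa [norm_mul, zn3, one_mul]
  have c4 : ‖ζ^3 * q‖ < 1 := by rwa [norm_mul, zn3, one_mul]
  have zq0 : ζ * q ≠ 0 := mul_ne_zero z0 hq0
  have z3q0 : ζ^3 * q ≠ 0 := mul_ne_zero (pow_ne_zero 3 z0) hq0
  have i1 : q^2 / (ζ * q) = -ζ^3 * q := by
    rw [div_eq_iff zq0]; linear_combination q^2 * hz
  have i3 : q^2 / (ζ^3 * q) = -ζ * q := by
    rw [div_eq_iff z3q0]; linear_combination q^2 * hz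
  have hm := master (r := q) (z := ζ * q) (w := ζ^3 * q) hq0 hq c1 c2 c3 c4
  have h3 := J_three hq02 h2 c1 c2 c3 c4
  have jn : ∀ m : ℕ, Odd m → J m (q^2) (ζ * q) =
      ∑' n : ℕ, (n:ℂ)^m * (ζ^n + (-ζ^3)^n) * (q^n / (1 - (q^n)^2)) := by
    intro m hm
    rw [J_nat hm hq02 h2 c1 c2, i1]
    congr 1; ext n
    rw [← pow_mul q 2, mul_comm 2, pow_mul, mul_pow, mul_pow]; ring
  have jn3 : ∀ m : ℕ, Odd m → J m (q^2) (ζ^3 * q) =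
      ∑' n : ℕ, (n:ℂ)^m * ((ζ^3)^n + (-ζ)^n) * (q^n / (1 - (q^n)^2)) := by
    intro m hm
    rw [J_nat hm hq02 h2 c3 c4, i3]
    congr 1; ext n
    rw [← pow_mul q 2, mul_comm 2, pow_mul, mul_pow, mul_pow]; ring
  have hsum : ∀ (m : ℕ) (u : ℂ), ‖u‖ = 1 → Summable fun n : ℕ => (n:ℂ)^m * u^n * (q^n / (1 - (q^n)^2)) :=
    fun m u hu => by
      simpa using summable_L hq (c := fun n => (n:ℂ)^m * u^n) (m := m) (C := 1) (by simp [hu]) one_ne_zero two_ne_zero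
  have zn' : ‖-ζ‖ = 1 := by rwa [norm_neg]
  have zn3' : ‖-ζ^3‖ = 1 := by rwa [norm_neg]
  have sa : ∀ m : ℕ, Summable fun n : ℕ => (n:ℂ)^m * (ζ^n + (-ζ^3)^n) * (q^n / (1 - (q^n)^2)) := fun m =>
    ((hsum m _ zn).add (hsum m _ zn3')).congr fun n => by ring
  have sb : ∀ m : ℕ, Summable fun n : ℕ => (n:ℂ)^m * ((ζ^3)^n + (-ζ)^n) * (q^n / (1 - (q^n)^2)) := fun m =>
    ((hsum m _ zn3).add (hsum m _ zn')).congr fun n => by ring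
  have l1 : J 1 (q^2) (ζ * q) + J 1 (q^2) (ζ^3 * q) = 16 * (5 * S (q^8) - 4 * S (q^16) - S (q^4)) := by
    have e0 : J 1 (q^2) (ζ * q) + J 1 (q^2) (ζ^3 * q) = (Lam ζ q + Lam (-ζ) q) + (Lam (ζ^3) q + Lam (-ζ^3) q) := by
      have a1 : J 1 (q^2) (ζ * q) = Lam ζ q + Lam (-ζ^3) q := by
        rw [jn 1 odd_one]; unfold Lam
        rw [← (summable_Lam zn hq).tsum_add (summable_Lam zn3' hq)]
        congr 1; ext n; ring
      have a2 : J 1 (q^2) (ζ^3 * q) = Lam (ζ^3) q + Lam (-ζ) q := by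
        rw [jn3 1 odd_one]; unfold Lam
        rw [← (summable_Lam zn3 hq).tsum_add (summable_Lam zn' hq)]
        congr 1; ext n; ring
      rw [a1, a2]; ring
    have e1 : (ζ^3)^2 = -ζ^2 := by linear_combination ζ^2 * hz
    have e2 := Lam_neg (u := ζ^2) (by rw [norm_pow, zn, one_pow]) h2
    have e3 := Lam_neg (u := 1) (by norm_num) h4
    rw [show (ζ^2)^2 = ζ^4 by ring, hz, show (q^2)^2 = q^4 by ring] at e2
    rw [one_pow, Lam_one h4, show (q^4)^2 = q^8 by ring, Lam_one h8, show (q^8)^2 = q^16 by ring] at e3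
    rw [e0, Lam_neg zn hq, Lam_neg zn3 hq, e1]
    linear_combination 4 * e2 + 16 * e3
  have l3 : J 3 (q^2) (ζ * q) - J 3 (q^2) (ζ^3 * q) = 2 * (ζ - ζ^3) * LBo q := by
    rw [jn 3 (by decide), jn3 3 (by decide), ← (sa 3).tsum_sub (sb 3)]
    unfold LBo
    rw [← tsum_mul_left]
    congr 1; ext n
    linear_combination ((n:ℂ)^3 * (q^n / (1 - (q^n)^2))) * chi_zeta hz n
  rw [l1, l3, D_eq hq02 h2] at h3
  have t12 : theta q (ζ * q) * theta q (ζ^3 * q) = E (q^2)^2 * P (-q^4) ((q^4)^2) := by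
    have a1 := P_sq (ζ * q) h2
    have a2 := P_sq (ζ^3 * q) h2
    have a3 := P_sq ((ζ * q)^2) (norm_sq_lt h2)
    rw [show (ζ^3 * q)^2 = -(ζ * q)^2 by linear_combination (ζ^2 * q^2) * hz] at a2
    rw [show ((ζ * q)^2)^2 = -q^4 by linear_combination (q^4) * hz, ← a1, ← a2, show (q^2)^2 = q^4 by ring] at a3
    rw [jtp hq0 hq zq0, jtp hq0 hq z3q0, i1, i3, ← a3, ← E]
    rw [show -ζ^3 * q = -(ζ^3 * q) by ring, show -ζ * q = -(ζ * q) by ring]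
    ring
  have t3 : theta q (ζ^3 * q * (ζ * q)) = 2 * E (q^4)^2 / E (q^2) := by
    rw [← theta_neg_one hq0 hq, show ζ^3 * q * (ζ * q) = -q^2 by linear_combination q^2 * hz,
      jtp hq0 hq (neg_ne_zero.2 hq02), jtp hq0 hq (by norm_num), show q^2 / -q^2 = -1 by field_simp,
      show q^2 / -1 = -q^2 by ring]
    ring
  have pn4 := Pn_eq h4
  rw [show (q^4)^2 = q^8 by ring] at pn4
  have t4 : theta q ((ζ^3 * q)⁻¹ * (ζ * q)) = (1 + ζ^2) * E (q^2) * (E (q^8) / E (q^4)) := by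
    have a1 := P_sq (ζ^2 * q^2) h2
    rw [show (ζ^2 * q^2)^2 = -q^4 by linear_combination q^4 * hz, show (q^2)^2 = q^4 by ring, pn4] at a1
    have a2 : (ζ^3 * q)⁻¹ * (ζ * q) = -ζ^2 := by
      rw [inv_mul_eq_iff_eq_mul₀ z3q0]; linear_combination (ζ * q) * hz
    have z2 : -ζ^2 ≠ 0 := neg_ne_zero.2 (pow_ne_zero 2 z0)
    have a3 : q^2 / -ζ^2 = ζ^2 * q^2 := by
      rw [div_eq_iff z2]; linear_combination q^2 * hz
    rw [a2, jtp hq0 hq z2, a3, P_shift (-ζ^2) h2, ← a1, ← E, show -ζ^2 * q^2 = -(ζ^2 * q^2) by ring]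
    ring
  have pno := Pno_eq h4
  rw [show (q^4)^2 = q^8 by ring, show (q^4)^4 = q^16 by ring] at pno
  have n1 := E_ne hq
  have n2 := E_ne h2
  have n4 := E_ne h4
  have n8 := E_ne h8
  have n16 := E_ne h16
  rw [← mul_pow, t12, t3, t4, show (q^4)^2 = q^8 by ring, pno, ← E] at hm
  have key : J 1 (q^2) (ζ * q) - J 1 (q^2) (ζ^3 * q) =
      2 * (ζ - ζ^3) * (Phi q * Phi (q^2) * Phi (-q) * dd q / 2) := by
    rw [dd_eq hq0 hq, Phi_eq hq02 h2, Phi_eq hq0 hq, Phi_neg_eq hq0 hq, show (q^2)^2 = q^4 by ring,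
      show (q^2)^4 = q^8 by ring]
    generalize J 1 (q^2) (ζ * q) - J 1 (q^2) (ζ^3 * q) = y at *
    field_simp at hm ⊢
    have zz : ζ^3 * (1 + ζ^2) = ζ^3 - ζ := by linear_combination ζ * hz
    linear_combination hm - 2 * (q * E (q^2)^2 * E (q^4)^3 * E (q^16)^2) * zz
  rw [key] at h3
  have h2s : 2 * (ζ - ζ^3) ≠ 0 := mul_ne_zero two_ne_zero s0
  apply mul_left_cancel₀ h2s
  rw [h3]; ring

end RF6

namespace RF6
open Filter Topology

lemma Phi_lim : Tendsto Phi (𝓝 0) (𝓝 1) := by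
  have hb := summable_Phi (q := (1/2 : ℂ)) (by norm_num) (by norm_num)
  have hlim : Tendsto Phi (𝓝 0) (𝓝 (∑' n : ℤ, if n = 0 then (1:ℂ) else 0)) := by
    refine tendsto_tsum_of_dominated_convergence hb (fun n => ?_) ?_
    · have e1 : ∀ x : ℂ, x ^ (n^2) = x ^ (n.natAbs ^ 2) := fun x => by
        rw [← zpow_natCast]; congr 1; push_cast; simp
      simp only [e1]
      by_cases hn : n = 0
      · simp [hn]
      · rw [if_neg hn]
        have : (0:ℂ) ^ (n.natAbs ^ 2) = 0 := zero_pow (by positivity)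
        have h2 := (continuous_pow (M := ℂ) (n.natAbs ^ 2)).tendsto 0
        rwa [this] at h2
    · have : ∀ᶠ x : ℂ in 𝓝 0, ‖x‖ < 1/2 :=
        (continuous_norm.tendsto (0:ℂ)).eventually_lt_const (by norm_num)
      filter_upwards [this] with x hx n
      have e1 : ∀ x : ℂ, x ^ (n^2) = x ^ (n.natAbs ^ 2) := fun x => by
        rw [← zpow_natCast]; congr 1; push_cast; simp
      rw [e1, e1, norm_pow, norm_pow]
      gcongr
      refine hx.le.trans (by norm_num)
  rwa [tsum_ite_eq] at hlim

lemma L_lim {c : ℕ → ℂ} {m : ℕ} (hc : ∀ n, ‖c n‖ ≤ (n:ℝ)^m) :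
    Tendsto (fun x : ℂ => ∑' n : ℕ, c n * (x^n / (1 - x^n))) (𝓝 0) (𝓝 0) := by
  have hb := (summable_pow_geom m (x := 1/2) (by norm_num) (by norm_num)).mul_left 2
  have hlim : Tendsto (fun x : ℂ => ∑' n : ℕ, c n * (x^n / (1 - x^n))) (𝓝 0) (𝓝 (∑' n : ℕ, (0:ℂ))) := by
    refine tendsto_tsum_of_dominated_convergence hb (fun n => ?_) ?_
    · by_cases hn : n = 0
      · simp [hn]
      · have h2 : Tendsto (fun x : ℂ => x^n) (𝓝 0) (𝓝 0) := by
          have h2 := (continuous_pow (M := ℂ) n).tendsto 0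
          rwa [zero_pow hn] at h2
        have := (h2.div (tendsto_const_nhds.sub h2 : Tendsto (fun x : ℂ => 1 - x^n) (𝓝 0) (𝓝 (1 - 0)))
          (by norm_num)).const_mul (c n)
        simpa using this
    · have : ∀ᶠ x : ℂ in 𝓝 0, ‖x‖ < 1/2 :=
        (continuous_norm.tendsto (0:ℂ)).eventually_lt_const (by norm_num)
      filter_upwards [this] with x hx n
      have hx1 : ‖x‖ < 1 := by linarith
      have h1 := inv_one_sub_le hx1 one_ne_zero n
      rw [pow_one] at h1
      have h2 : (1 - ‖x‖)⁻¹ ≤ 2 := by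
        rw [inv_le_comm₀ (by linarith) (by norm_num)]; linarith
      rw [norm_mul, div_eq_mul_inv, norm_mul, norm_pow]
      calc _ ≤ (n:ℝ)^m * ((1/2)^n * 2) := by
            gcongr
            · exact hc n
            · exact h1.trans h2
        _ = _ := by ring
  rwa [tsum_zero] at hlim

lemma S_lim : Tendsto S (𝓝 0) (𝓝 0) :=
  L_lim (c := fun n => (n:ℂ)) (m := 1) (by simp)

lemma LB_lim : Tendsto LB (𝓝 0) (𝓝 0) :=
  L_lim (c := fun n => (n:ℂ)^3 * chi n) (m := 3) (fun n => by
      rw [norm_mul, norm_n]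
      exact mul_le_of_le_one_right (by positivity) (chi_norm n))

lemma rec_zero {g : ℂ → ℂ} (h1 : ∀ q : ℂ, q ≠ 0 → ‖q‖ < 1 → g q = g (q^2)) (h2 : Tendsto g (𝓝 0) (𝓝 0))
    {q : ℂ} (hq0 : q ≠ 0) (hq : ‖q‖ < 1) : g q = 0 := by
  have h3 : ∀ k : ℕ, g (q ^ (2^k)) = g q := by
    intro k
    induction k with
    | zero => simp
    | succ k ih =>
      rw [pow_succ 2 k, pow_mul, ← h1 _ (pow_ne_zero _ hq0) (norm_pow_lt hq (by positivity)), ih]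
  have h4 : Tendsto (fun k : ℕ => q ^ (2^k)) atTop (𝓝 0) :=
    (tendsto_pow_atTop_nhds_zero_of_norm_lt_one hq).comp (tendsto_atTop_mono (fun k => (Nat.lt_two_pow_self (n := k)).le) tendsto_id)
  have h5 := h2.comp h4
  simp only [Function.comp_def, h3] at h5
  exact tendsto_nhds_unique tendsto_const_nhds h5

lemma pow_lim {n : ℕ} (hn : n ≠ 0) : Tendsto (fun x : ℂ => x^n) (𝓝 0) (𝓝 0) := by
  have h2 := (continuous_pow (M := ℂ) n).tendsto 0
  rwa [zero_pow hn] at h2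

lemma four_sq {q : ℂ} (hq0 : q ≠ 0) (hq : ‖q‖ < 1) : Phi q ^ 4 = 1 + 8 * S q - 32 * S (q^4) := by
  have := rec_zero (g := fun q => Phi q ^ 4 - (1 + 8 * S q - 32 * S (q^4))) ?_ ?_ hq0 hq
  · exact sub_eq_zero.1 this
  · intro q hq0 hq
    have y1 := Y_eq hq0 hq
    have y2 := Y_eq (pow_ne_zero 2 hq0) (norm_sq_lt hq)
    have r1 := Phi_split hq0 hq
    have r2 := Phi_sq hq0 hq
    rw [show (q^2)^2 = q^4 by ring, show (q^2)^4 = q^8 by ring] at *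
    have e : Phi q ^ 4 - Phi (q^2) ^ 4 = 2 * (Phi (q^2) ^ 2 * (Phi q ^ 2 - Phi (q^2)^2)) +
        4 * (Phi (q^4) ^ 2 * (Phi (q^2) ^ 2 - Phi (q^4)^2)) := by
      rw [show Phi (q^2)^4 = (Phi (q^2)^2)^2 by ring, r2, r1]; ring
    linear_combination e - 8 * y1 - 16 * y2
  · have := ((Phi_lim.pow 4).sub ((tendsto_const_nhds (x := (1:ℂ))).add (S_lim.const_mul 8) |>.sub
      ((S_lim.comp (pow_lim (n := 4) (by norm_num))).const_mul 32)))
    simpa using this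

lemma LA_poly {q : ℂ} (hq0 : q ≠ 0) (hq : ‖q‖ < 1) :
    16 * LA q = Phi q * Phi (q^2) * (Phi q ^ 2 - Phi (q^2)^2) *
      (Phi q ^ 4 + 4 * Phi q ^ 2 * Phi (q^2) ^ 2 - Phi (q^2) ^ 4) := by
  have y1 := Y_eq hq0 hq
  have x1 := four_sq hq0 hq
  have x2 := four_sq (pow_ne_zero 2 hq0) (norm_sq_lt hq)
  rw [← pow_mul] at x2
  norm_num at x2
  have : 6 * (S q - S (q^2)) + 1 - 24 * S (q^8) =
      (Phi q ^ 4 + 4 * Phi q ^ 2 * Phi (q^2) ^ 2 - Phi (q^2) ^ 4) / 4 := by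
    linear_combination 4 * y1 - x1 / 4 - 3 / 4 * x2
  rw [LA_eq hq0 hq, this]; ring

lemma LBo_poly {q : ℂ} (hq0 : q ≠ 0) (hq : ‖q‖ < 1) :
    2 * LBo q = Phi q * Phi (q^2) * (Phi (q^4) - dd q) * dd q *
      (Phi (q^4)^4 - 6 * Phi (q^4)^2 * dd q^2 - 11 * dd q^4) := by
  have y2 := Y_eq (pow_ne_zero 2 hq0) (norm_sq_lt hq)
  have x2 := four_sq (pow_ne_zero 2 hq0) (norm_sq_lt hq)
  have x4 := four_sq (pow_ne_zero 4 hq0) (norm_pow_lt hq (by norm_num))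
  have r2 := Phi_sq hq0 hq
  rw [show (q^2)^2 = q^4 by ring, show (q^2)^4 = q^8 by ring] at y2
  rw [show (q^2)^4 = q^8 by ring, show Phi (q^2)^4 = (Phi (q^2)^2)^2 by ring] at x2
  rw [show (q^4)^4 = q^16 by ring] at x4
  rw [r2] at y2 x2
  have : 96 * (5 * S (q^8) - 4 * S (q^16) - S (q^4)) + 1 - 24 * S (q^2) =
      Phi (q^4)^4 - 6 * Phi (q^4)^2 * dd q^2 - 11 * dd q^4 := by
    linear_combination 64 * y2 - 12 * x4 + 11 * x2
  rw [LBo_eq hq0 hq, this, Phi_neg_split hq0 hq]; ring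

lemma LB_poly {q : ℂ} (hq0 : q ≠ 0) (hq : ‖q‖ < 1) :
    11 + 2 * LB q = Phi q ^ 7 * Phi (q^2) - 10 * Phi q ^ 5 * Phi (q^2) ^ 3 + 12 * Phi q ^ 3 * Phi (q^2) ^ 5
      + 8 * Phi q * Phi (q^2) ^ 7 := by
  have := rec_zero (g := fun q => 11 + 2 * LB q - (Phi q ^ 7 * Phi (q^2) - 10 * Phi q ^ 5 * Phi (q^2) ^ 3
    + 12 * Phi q ^ 3 * Phi (q^2) ^ 5 + 8 * Phi q * Phi (q^2) ^ 7)) ?_ ?_ hq0 hq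
  · exact sub_eq_zero.1 this
  · intro q hq0 hq
    have h1 := LB_sub hq
    have h2 := LBo_poly hq0 hq
    have r1 := Phi_split hq0 hq
    have r2 := Phi_sq hq0 hq
    rw [show (q^2)^2 = q^4 by ring]
    rw [r1] at h2 ⊢
    generalize Phi (q^4) = c at *
    generalize Phi (q^2) = b at *
    generalize dd q = d at *
    have e : ((c+d)^7 * b - 10 * (c+d)^5 * b^3 + 12 * (c+d)^3 * b^5 + 8 * (c+d) * b^7) -
      (b^7 * c - 10 * b^5 * c^3 + 12 * b^3 * c^5 + 8 * b * c^7) =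
        (c + d) * b * (c - d) * d * (c^4 - 6 * c^2 * d^2 - 11 * d^4) := by
      rw [show b^7 = b * (b^2)^3 by ring, show b^5 = b * (b^2)^2 by ring, show b^3 = b * b^2 by ring, r2]; ring
    linear_combination 2 * h1 + h2 - e
  · have l1 := Phi_lim
    have l2 := Phi_lim.comp (pow_lim (n := 2) (by norm_num))
    have := ((tendsto_const_nhds (x := (11:ℂ))).add (LB_lim.const_mul 2)).sub
      (((((l1.pow 7).mul l2).sub (((l1.pow 5).const_mul 10).mul (l2.pow 3))).add
      (((l1.pow 3).const_mul 12).mul (l2.pow 5))).add ((l1.const_mul 8).mul (l2.pow 7)))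
    norm_num [Function.comp_def] at this
    exact this

end RF6

namespace RF6
open Filter Topology

noncomputable def A1 (q : ℂ) : ℂ := q * (E q ^ (-2:ℤ) * E (q^2) ^ (11:ℤ) * E (q^4) ^ (-3:ℤ) * E (q^8) ^ (2:ℤ))
noncomputable def A2 (q : ℂ) : ℂ := q * (E q ^ (2:ℤ) * E (q^2) ^ (-3:ℤ) * E (q^4) ^ (11:ℤ) * E (q^8) ^ (-2:ℤ))

lemma Phi_neg_sq {q : ℂ} (hq0 : q ≠ 0) (hq : ‖q‖ < 1) : Phi (-q) ^ 2 = 2 * Phi (q^2)^2 - Phi q ^ 2 := by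
  rw [Phi_neg_split hq0 hq, Phi_split hq0 hq, Phi_sq hq0 hq]; ring

lemma A_poly {q : ℂ} (hq0 : q ≠ 0) (hq : ‖q‖ < 1) :
    A1 q = Phi q ^ 3 * Phi (q^2) * (2 * Phi (q^2)^2 - Phi q ^ 2) * (Phi q ^ 2 - Phi (q^2)^2) / 4 ∧
    A2 q = Phi q * Phi (q^2) ^ 3 * (2 * Phi (q^2)^2 - Phi q ^ 2) * (Phi q ^ 2 - Phi (q^2)^2) / 4 := by
  rw [← Phi_neg_sq hq0 hq, ab_eq hq0 hq, Phi_neg_eq hq0 hq, Phi_eq hq0 hq, 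
    Phi_eq (pow_ne_zero 2 hq0) (norm_sq_lt hq), show (q^2)^2 = q^4 by ring, show (q^2)^4 = q^8 by ring, A1, A2]
  have n1 := E_ne hq
  have n2 := E_ne (norm_sq_lt hq)
  have n4 := E_ne (norm_pow_lt hq (n := 4) (by norm_num))
  have n8 := E_ne (norm_pow_lt hq (n := 8) (by norm_num))
  have k2 (x : ℂ) : x ^ (-2:ℤ) = (x^2)⁻¹ := by rw [zpow_neg]; rfl
  have k3 (x : ℂ) : x ^ (-3:ℤ) = (x^3)⁻¹ := by rw [zpow_neg]; rfl
  have k4 (x : ℂ) : x ^ (2:ℤ) = x^2 := rfl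
  have k5 (x : ℂ) : x ^ (11:ℤ) = x^11 := rfl
  simp only [k2, k3, k4, k5]
  constructor <;> field_simp

lemma final_poly {q : ℂ} (hq0 : q ≠ 0) (hq : ‖q‖ < 1) :
    11 * (Phi q ^ 3 * Phi (q^2) * Phi (q^4)^4) = 11 + 8 * LA q + 2 * LB (q^2) + 13 * A1 q + 45 * A2 q
      + 136 * A1 (q^2) + 16 * A2 (q^2) := by
  have h1 := LA_poly hq0 hq
  have h2 := LB_poly (pow_ne_zero 2 hq0) (norm_sq_lt hq)
  obtain ⟨h3, h4⟩ := A_poly hq0 hq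
  obtain ⟨h5, h6⟩ := A_poly (pow_ne_zero 2 hq0) (norm_sq_lt hq)
  have r1 := Phi_split hq0 hq
  have r2 := Phi_sq hq0 hq
  rw [show (q^2)^2 = q^4 by ring] at *
  rw [h3, h4, h5, h6]
  have h1' : 8 * LA q = (16 * LA q) / 2 := by ring
  rw [h1', h1, show (11:ℂ) + (Phi q * Phi (q ^ 2) * (Phi q ^ 2 - Phi (q ^ 2) ^ 2) * (Phi q ^ 4 + 4 * Phi q ^ 2 * Phi (q ^ 2) ^ 2 - Phi (q ^ 2) ^ 4)) / 2 + 2 * LB (q^2) = 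
    (11 + 2 * LB (q^2)) + (Phi q * Phi (q ^ 2) * (Phi q ^ 2 - Phi (q ^ 2) ^ 2) * (Phi q ^ 4 + 4 * Phi q ^ 2 * Phi (q ^ 2) ^ 2 - Phi (q ^ 2) ^ 4)) / 2 by ring, h2, r1]
  generalize Phi (q^4) = c at *
  generalize Phi (q^2) = b at *
  generalize dd q = d at *
  rw [show b^7 = b * (b^2)^3 by ring, show b^5 = b * (b^2)^2 by ring, show b^4 = (b^2)^2 by ring, show b^3 = b * b^2 by ring, r2]; ring

end RF6

namespace RF6
open Filter Topology

lemma eta_eq (z : ℂ) : dedekindEta z = Complex.exp (Real.pi * Complex.I * z / 12) *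
    E (Complex.exp (2 * Real.pi * Complex.I * z)) := by
  unfold dedekindEta E P
  congr 1
  apply tprod_congr
  intro m
  rw [← Complex.exp_nat_mul, ← Complex.exp_add]
  congr 2; ring

lemma eta_mul (z : ℂ) (k : ℕ) : dedekindEta (k * z) = Complex.exp (Real.pi * Complex.I * z / 12) ^ k *
    E (Complex.exp (2 * Real.pi * Complex.I * z) ^ k) := by
  rw [eta_eq, ← Complex.exp_nat_mul, ← Complex.exp_nat_mul]
  congr 2
  · ring
  · congr 1; ring

lemma exists_z {q : ℂ} (hq0 : q ≠ 0) (hq : ‖q‖ < 1) :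
    ∃ z : ℂ, 0 < z.im ∧ Complex.exp (2 * Real.pi * Complex.I * z) = q := by
  refine ⟨Function.Periodic.invQParam 1 q, Function.Periodic.im_invQParam_pos_of_norm_lt_one one_pos hq hq0, ?_⟩
  have := Function.Periodic.qParam_right_inv (h := 1) one_ne_zero hq0
  simpa [Function.Periodic.qParam] using this

lemma eta_all (z : ℂ) : 
    dedekindEta z ^ (-2 : ℤ) * dedekindEta (2 * z) ^ (11 : ℤ) * dedekindEta (4 * z) ^ (-3 : ℤ) * dedekindEta (8 * z) ^ (2 : ℤ)
     = A1 (Complex.exp (2 * Real.pi * Complex.I * z)) ∧ 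
    dedekindEta z ^ (2 : ℤ) * dedekindEta (2 * z) ^ (-3 : ℤ) * dedekindEta (4 * z) ^ (11 : ℤ) * dedekindEta (8 * z) ^ (-2 : ℤ)
     = A2 (Complex.exp (2 * Real.pi * Complex.I * z)) := by
  have e1 := eta_mul z 1
  have e2 := eta_mul z 2
  have e4 := eta_mul z 4
  have e8 := eta_mul z 8
  have eq : Complex.exp (2 * Real.pi * Complex.I * z) = Complex.exp (Real.pi * Complex.I * z / 12) ^ 24 := by
    rw [← Complex.exp_nat_mul]; congr 1; push_cast; ring
  push_cast at e1 e2 e4 e8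
  rw [one_mul] at e1
  rw [e1, e2, e4, e8, A1, A2]
  have hu : Complex.exp (Real.pi * Complex.I * z / 12) ≠ 0 := Complex.exp_ne_zero _
  rw [pow_one (Complex.exp (2 * Real.pi * Complex.I * z))]
  generalize E (Complex.exp (2 * Real.pi * Complex.I * z)) = x1
  generalize E (Complex.exp (2 * Real.pi * Complex.I * z)^2) = x2
  generalize E (Complex.exp (2 * Real.pi * Complex.I * z)^4) = x4
  generalize E (Complex.exp (2 * Real.pi * Complex.I * z)^8) = x8
  rw [eq]
  generalize Complex.exp (Real.pi * Complex.I * z / 12) = u at hu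
  have k2 (x : ℂ) : x ^ (-2:ℤ) = (x^2)⁻¹ := by rw [zpow_neg]; rfl
  have k3 (x : ℂ) : x ^ (-3:ℤ) = (x^3)⁻¹ := by rw [zpow_neg]; rfl
  have k4 (x : ℂ) : x ^ (2:ℤ) = x^2 := rfl
  have k5 (x : ℂ) : x ^ (11:ℤ) = x^11 := rfl
  simp only [k2, k3, k4, k5, mul_pow, mul_inv, ← pow_mul]
  constructor <;> field_simp <;> ring

lemma A_ne {q : ℂ} (hq0 : q ≠ 0) (hq : ‖q‖ < 1) : A1 q ≠ 0 ∧ A2 q ≠ 0 := by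
  have n1 := E_ne hq
  have n2 := E_ne (norm_sq_lt hq)
  have n4 := E_ne (norm_pow_lt hq (n := 4) (by norm_num))
  have n8 := E_ne (norm_pow_lt hq (n := 8) (by norm_num))
  unfold A1 A2
  constructor <;> 
  refine mul_ne_zero hq0 (mul_ne_zero (mul_ne_zero (mul_ne_zero ?_ ?_) ?_) ?_) <;>
  exact zpow_ne_zero _ (by assumption)

lemma hasSum_A {a : ℕ → ℤ} {q A : ℂ} (hA : A ≠ 0) (h : A = ∑' m : ℕ, (a (m + 1) : ℂ) * q ^ (m+1)) :
    HasSum (fun n : ℕ => (if n = 0 then 0 else (a n : ℂ)) * q ^ n) A := by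
  have hs : Summable fun m : ℕ => (a (m + 1) : ℂ) * q ^ (m+1) := by
    by_contra hc
    exact hA (by rw [h, tsum_eq_zero_of_not_summable hc])
  rw [← hasSum_nat_add_iff' 1]
  simpa [h] using hs.hasSum

end RF6

namespace RF6
open Filter Topology

lemma double_sum {q : ℂ} (hq : ‖q‖ < 1) {u v : ℕ → ℂ} (hu : ∀ n, ‖u n‖ ≤ 1) (hv : ∀ n : ℕ, ‖v n‖ ≤ (n:ℝ)^3) 
    {g : ℕ → ℂ} (hg : ∀ n : ℕ, n ≠ 0 → HasSum (fun m : ℕ+ => u m * (q^n)^(m:ℕ)) (g n)) (hv0 : v 0 = 0) :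
    HasSum (fun n : ℕ => (∑ x ∈ n.divisorsAntidiagonal, u x.1 * v x.2) * q ^ n) (∑' n : ℕ, v n * g n) := by
  have s0 := summable_prod_mul_pow 3 (r := ‖q‖) (by simpa using hq)
  have s1 : Summable (fun c : ℕ+ × ℕ+ => u c.1 * v c.2 * q ^ (c.1 * c.2 : ℕ)) := by
    refine Summable.of_norm_bounded s0 ?_
    intro c
    rw [norm_mul, norm_mul, norm_pow]
    gcongr
    calc _ ≤ 1 * ((c.2:ℕ):ℝ)^3 := mul_le_mul (hu _) (hv _) (norm_nonneg _) zero_le_one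
      _ = _ := by simp
  have t1 := s1.hasSum
  have t2 : ∑' c : ℕ+ × ℕ+, u c.1 * v c.2 * q ^ (c.1 * c.2 : ℕ) = ∑' n : ℕ, v n * g n := by
    have s2 : Summable (fun c : ℕ+ × ℕ+ => u (Equiv.prodComm ℕ+ ℕ+ c).1 * v (Equiv.prodComm ℕ+ ℕ+ c).2 *
        q ^ ((Equiv.prodComm ℕ+ ℕ+ c).1 * (Equiv.prodComm ℕ+ ℕ+ c).2 : ℕ)) :=
      (Equiv.prodComm ℕ+ ℕ+).summable_iff.2 s1
    rw [← (Equiv.prodComm ℕ+ ℕ+).tsum_eq, Summable.tsum_prod s2]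
    have : ∑' n : ℕ, v n * g n = ∑' n : ℕ+, v n * g n := by
      rw [PNat.coe_injective.tsum_eq (f := fun n : ℕ => v n * g n)]
      intro n hn
      by_cases h0 : n = 0
      · subst h0; simp [hv0] at hn
      · exact ⟨⟨n, Nat.pos_of_ne_zero h0⟩, rfl⟩
    rw [this]
    apply tsum_congr
    intro n
    rw [← (hg n n.ne_zero).tsum_eq, ← tsum_mul_left]
    apply tsum_congr
    intro m
    simp only [Equiv.prodComm_apply, Prod.swap_prod_mk]
    rw [← pow_mul, mul_comm (m:ℕ) (n:ℕ)]; ring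
  rw [t2] at t1
  rw [← sigmaAntidiagonalEquivProd.hasSum_iff] at t1
  have t3 := t1.sigma (g := fun n : ℕ+ => (∑ x ∈ (n:ℕ).divisorsAntidiagonal, u x.1 * v x.2) * q ^ (n:ℕ)) (by
    intro n
    convert hasSum_fintype _ using 1
    rw [Finset.sum_mul, ← Finset.sum_coe_sort]
    apply Finset.sum_congr rfl
    intro x hx
    have := (Nat.mem_divisorsAntidiagonal.mp x.2).1
    simp only [Function.comp, sigmaAntidiagonalEquivProd, divisorsAntidiagonalFactors, Equiv.coe_fn_mk, PNat.mk_coe]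
    rw [this])
  rw [← PNat.coe_injective.hasSum_iff]
  · exact t3
  · intro n hn
    have : n = 0 := by
      by_contra h0
      exact hn ⟨⟨n, Nat.pos_of_ne_zero h0⟩, rfl⟩
    simp [this]

lemma pnat_of_nat {f : ℕ → ℂ} {a : ℂ} (h : HasSum f a) (h0 : f 0 = 0) : HasSum (fun n : ℕ+ => f n) a := by
  have := (PNat.coe_injective.hasSum_iff (f := f) (a := a) ?_).2 h
  · exact this
  · intro n hn
    have : n = 0 := by
      by_contra h0
      exact hn ⟨⟨n, Nat.pos_of_ne_zero h0⟩, rfl⟩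
    simp [this, h0]

lemma geom_pnat {x : ℂ} (hx : ‖x‖ < 1) : HasSum (fun m : ℕ+ => x^(m:ℕ)) (x / (1 - x)) := by
  have h := (hasSum_geometric_of_norm_lt_one hx).mul_left x
  have h2 := (Equiv.pnatEquivNat.hasSum_iff).2 h
  refine (hs_congr h2 ?_ ?_)
  · intro n
    simp [← pow_succ']
  · ring

lemma chi_geom {x : ℂ} (hx : ‖x‖ < 1) : HasSum (fun m : ℕ+ => chi m * x^(m:ℕ)) ((x-x^3-x^5+x^7) / (1 - x^8)) := by
  have hs : Summable (fun m : ℕ => chi m * x^m) := by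
    refine Summable.of_norm_bounded (summable_geometric_of_lt_one (norm_nonneg _) hx) ?_
    intro m
    rw [norm_mul, norm_pow]
    exact mul_le_of_le_one_left (by positivity) (chi_norm m)
  have hT := hs.sum_add_tsum_nat_add 8
  have hp : ∀ m : ℕ, chi (m+8) = chi m := by
    intro m
    have : ((m + 8 : ℕ) : ZMod 8) = (m : ZMod 8) := by
      push_cast
      rw [show (8:ZMod 8) = 0 from rfl, add_zero]
    simp only [chi, this]
  have e : ∑' m : ℕ, chi (m+8) * x^(m+8) = x^8 * ∑' m : ℕ, chi m * x^m := by
    rw [← tsum_mul_left]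
    apply tsum_congr
    intro m
    rw [hp]; ring
  have c0 : chi 0 = 0 := by simp [chi]
  have c1 : chi 1 = 1 := by simp [chi]
  have c2 : chi 2 = 0 := by have : ZMod.χ₈ ((2:ℕ):ZMod 8) = 0 := by decide
                            simp [chi, -Nat.cast_ofNat, this]
  have c3 : chi 3 = -1 := by have : ZMod.χ₈ ((3:ℕ):ZMod 8) = -1 := by decide
                             simp [chi, -Nat.cast_ofNat, this]
  have c4 : chi 4 = 0 := by have : ZMod.χ₈ ((4:ℕ):ZMod 8) = 0 := by decide
                            simp [chi, -Nat.cast_ofNat, this]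
  have c5 : chi 5 = -1 := by have : ZMod.χ₈ ((5:ℕ):ZMod 8) = -1 := by decide
                             simp [chi, -Nat.cast_ofNat, this]
  have c6 : chi 6 = 0 := by have : ZMod.χ₈ ((6:ℕ):ZMod 8) = 0 := by decide
                            simp [chi, -Nat.cast_ofNat, this]
  have c7 : chi 7 = 1 := by have : ZMod.χ₈ ((7:ℕ):ZMod 8) = 1 := by decide
                            simp [chi, -Nat.cast_ofNat, this]
  rw [e] at hT
  simp only [Finset.sum_range_succ, Finset.sum_range_zero, c0, c1, c2, c3, c4, c5, c6, c7] at hT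
  have n8 : 1 - x^8 ≠ 0 := by
    intro h0
    exact pow_ne_one' hx (n := 8) (by norm_num) (by linear_combination -h0)
  have hv : ∑' m : ℕ, chi m * x^m = (x-x^3-x^5+x^7) / (1 - x^8) := by
    rw [eq_div_iff n8]
    linear_combination -hT
  have := hs.hasSum
  rw [hv] at this
  exact pnat_of_nat this (by simp [c0])

lemma hasSum_LA {q : ℂ} (hq : ‖q‖ < 1) : HasSum (fun n : ℕ => (sigmaChi8One n : ℂ) * q ^ n) (LA q) := by
  have := double_sum hq (u := chi) (v := fun n => (n:ℂ)^3) chi_norm (fun n => (norm_n 3).le)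
    (g := fun n => ((q^n-(q^n)^3-(q^n)^5+(q^n)^7)/(1-(q^n)^8))) 
    (fun n hn => chi_geom (norm_pow_lt hq hn)) (by simp)
  refine hs_congr this ?_ rfl
  intro n
  congr 1
  rw [Nat.sum_divisorsAntidiagonal' (f := fun x y => chi x * (y:ℂ)^3)]
  simp [sigmaChi8One, chi]

lemma hasSum_LB {q : ℂ} (hq : ‖q‖ < 1) : HasSum (fun n : ℕ => (sigmaOneChi8 n : ℂ) * q ^ n) (LB q) := by
  have := double_sum hq (u := fun _ => 1) (v := fun n => (n:ℂ)^3 * chi n) (by simp) (fun n => by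
      rw [norm_mul, norm_n]
      exact mul_le_of_le_one_right (by positivity) (chi_norm n))
    (g := fun n => q^n/(1-q^n)) 
    (fun n hn => by simpa using geom_pnat (norm_pow_lt hq hn)) (by simp)
  refine hs_congr this ?_ rfl
  intro n
  congr 1
  rw [Nat.sum_divisorsAntidiagonal' (f := fun x y => 1 * ((y:ℂ)^3 * chi y))]
  simp [sigmaOneChi8, chi, mul_comm]

end RF6

namespace RF6
open Filter Topology

lemma zpow_sum' {q : ℂ} (hq0 : q ≠ 0) {ι : Type*} (s : Finset ι) (f : ι → ℤ) :
    q ^ (∑ i ∈ s, f i) = ∏ i ∈ s, q ^ f i := by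
  classical
  induction s using Finset.induction_on with
  | empty => simp
  | insert a s ha ih => rw [Finset.sum_insert ha, Finset.prod_insert ha, zpow_add₀ hq0, ih]

lemma mul_sum {ι κ : Type*} {f : ι → ℂ} {g : κ → ℂ} {b : ℂ} (hf : Summable fun n => ‖f n‖)
    (hg : Summable fun n => ‖g n‖) (hb : HasSum g b) : 
    HasSum (fun x : ι × κ => f x.1 * g x.2) ((∑' n, f n) * b) :=
  hf.of_norm.hasSum.mul hb (summable_mul_of_summable_norm hf hg)

lemma prod_sum (k : ℕ) (f : Fin k → ℤ → ℂ) (hf : ∀ i, Summable fun n => ‖f i n‖) :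
    Summable (fun x : Fin k → ℤ => ‖∏ i, f i (x i)‖) ∧
    HasSum (fun x : Fin k → ℤ => ∏ i, f i (x i)) (∏ i, ∑' n, f i n) := by
  induction k with
  | zero =>
    constructor
    · exact (hasSum_fintype _).summable
    · simp
  | succ k ih =>
    obtain ⟨h1, h2⟩ := ih (fun i => f i.succ) (fun i => hf _)
    have m1 := (hf 0).mul_norm h1
    have m2 := mul_sum (hf 0) h1 h2
    constructor
    · rw [← (Fin.consEquiv (fun _ : Fin (k+1) => ℤ)).summable_iff]
      refine m1.congr ?_
      intro x
      simp [Fin.prod_univ_succ, Fin.consEquiv]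
    · rw [← (Fin.consEquiv (fun _ : Fin (k+1) => ℤ)).hasSum_iff, Fin.prod_univ_succ]
      refine hs_congr m2 ?_ rfl
      intro x
      simp [Fin.prod_univ_succ, Fin.consEquiv]

lemma rep_sum {q : ℂ} (hq0 : q ≠ 0) (hq : ‖q‖ < 1) (a : Fin 8 → ℕ) (ha : ∀ i, a i ≠ 0) :
    HasSum (fun n : ℕ => (repCount a n : ℂ) * q ^ n) (∏ i, Phi (q ^ (a i))) := by
  have h1 := (prod_sum 8 (fun i n => (q ^ (a i)) ^ (n^2)) (fun i => 
    summable_Phi (pow_ne_zero _ hq0) (norm_pow_lt hq (ha i)))).2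
  have h2 := h1.tsum_fiberwise (fun x : Fin 8 → ℤ => (∑ i, (a i : ℤ) * x i ^ 2).toNat)
  refine hs_congr h2 ?_ rfl
  intro n
  have e : ∀ x : ((fun x : Fin 8 → ℤ => (∑ i, (a i : ℤ) * x i ^ 2).toNat) ⁻¹' {n}), 
      ∏ i, (q ^ (a i)) ^ (x.1 i ^ 2) = q ^ n := by
    intro x
    have hx : (∑ i, (a i : ℤ) * x.1 i ^ 2).toNat = n := x.2
    have hp : 0 ≤ (∑ i, (a i : ℤ) * x.1 i ^ 2) := by positivity
    have hx2 : (∑ i, (a i : ℤ) * x.1 i ^ 2) = (n:ℤ) := by omega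
    rw [← zpow_natCast q n, ← hx2]
    simp only [← zpow_natCast, ← zpow_mul]
    rw [zpow_sum' hq0]
  rw [tsum_congr e, tsum_const, nsmul_eq_mul, repCount]
  congr 2
  apply Nat.card_congr
  apply Equiv.subtypeEquivRight
  intro x
  have hp : 0 ≤ (∑ i, (a i : ℤ) * x i ^ 2) := by positivity
  simp only [Set.mem_preimage, Set.mem_singleton_iff]
  omega

lemma half_sum {q F : ℂ} {f : ℕ → ℂ} (h : HasSum (fun n => f n * (q^2)^n) F) :
    HasSum (fun n : ℕ => (if 2 ∣ n then f (n/2) else 0) * q^n) F := by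
  have hi : Function.Injective (fun n : ℕ => 2 * n) := fun a b h => by simpa using h
  rw [← hi.hasSum_iff]
  · refine hs_congr h ?_ rfl
    intro n
    simp [pow_mul]
  · intro n hn
    have : ¬ 2 ∣ n := by
      rintro ⟨k, rfl⟩
      exact hn ⟨k, rfl⟩
    simp [this]

lemma coeff_zero {c : ℕ → ℂ} (h : ∀ q : ℂ, q ≠ 0 → ‖q‖ < 1 → HasSum (fun n => c n * q^n) 0) : c 0 = 0 := by
  have hs : Summable (fun n => ‖c n‖ * (1/2:ℝ)^n) := by
    have := (h (1/2) (by norm_num) (by norm_num)).summable.norm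
    simpa using this
  have hc : ContinuousOn (fun q : ℂ => ∑' n, c n * q^n) (Metric.closedBall 0 (1/2)) := by
    refine continuousOn_tsum (fun n => by fun_prop) hs ?_
    intro n x hx
    rw [norm_mul, norm_pow]
    gcongr
    simpa using hx
  have hc0 : ContinuousAt (fun q : ℂ => ∑' n, c n * q^n) 0 := 
    hc.continuousAt (Metric.closedBall_mem_nhds _ (by norm_num))
  have t1 : Tendsto (fun q : ℂ => ∑' n, c n * q^n) (𝓝[≠] 0) (𝓝 (∑' n, c n * (0:ℂ)^n)) := hc0.tendsto.mono_left nhdsWithin_le_nhds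
  have t2 : Tendsto (fun q : ℂ => ∑' n, c n * q^n) (𝓝[≠] 0) (𝓝 0) := by
    refine tendsto_const_nhds.congr' ?_
    filter_upwards [self_mem_nhdsWithin, mem_nhdsWithin_of_mem_nhds (Metric.ball_mem_nhds (0:ℂ) one_pos)] with q h1 h2
    exact (h q h1 (by simpa using h2)).tsum_eq.symm
  have := tendsto_nhds_unique t1 t2
  rw [tsum_eq_single 0 (by intro n hn; simp [hn])] at this
  simpa using this

lemma coeff_all (n : ℕ) : ∀ {c : ℕ → ℂ} (_ : ∀ q : ℂ, q ≠ 0 → ‖q‖ < 1 → HasSum (fun n => c n * q^n) 0), c n = 0 := by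
  induction n with
  | zero => intro c h; exact coeff_zero h
  | succ n ih =>
    intro c h
    apply ih (c := fun n => c (n+1))
    intro q hq0 hq
    have h1 := h q hq0 hq
    rw [← hasSum_nat_add_iff' 1] at h1
    have h2 := h1.mul_left q⁻¹
    refine hs_congr h2 ?_ ?_
    · intro n; field_simp; ring
    · simp [coeff_zero h]

end RF6

theorem representation_formula_6
    (a1 a2 : ℕ → ℤ)
    (ha1 : ∀ z : ℂ, 0 < z.im →
      dedekindEta z ^ (-2 : ℤ) * dedekindEta (2 * z) ^ (11 : ℤ) * dedekindEta (4 * z) ^ (-3 : ℤ) * dedekindEta (8 * z) ^ (2 : ℤ)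
        = ∑' m : ℕ, (a1 (m + 1) : ℂ) * Complex.exp (2 * Real.pi * Complex.I * z) ^ (m + 1))
    (ha2 : ∀ z : ℂ, 0 < z.im →
      dedekindEta z ^ (2 : ℤ) * dedekindEta (2 * z) ^ (-3 : ℤ) * dedekindEta (4 * z) ^ (11 : ℤ) * dedekindEta (8 * z) ^ (-2 : ℤ)
        = ∑' m : ℕ, (a2 (m + 1) : ℂ) * Complex.exp (2 * Real.pi * Complex.I * z) ^ (m + 1))
    (n : ℕ) (hn : 0 < n) :
    (repCount ![1, 1, 1, 2, 4, 4, 4, 4] n : ℚ) =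
    (((8 : ℚ) / 11) * (sigmaChi8One n : ℚ) + ((2 : ℚ) / 11) * half sigmaOneChi8 n
      + ((13 : ℚ) / 11) * (a1 n : ℚ) + ((45 : ℚ) / 11) * (a2 n : ℚ)
      + ((136 : ℚ) / 11) * half a1 n + ((16 : ℚ) / 11) * half a2 n) := by
  have h1 : ∀ q : ℂ, q ≠ 0 → ‖q‖ < 1 →
      HasSum (fun n : ℕ => (if n = 0 then 0 else (a1 n : ℂ)) * q ^ n) (RF6.A1 q) := by
    intro q hq0 hq
    obtain ⟨z, hz, rfl⟩ := RF6.exists_z hq0 hq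
    exact RF6.hasSum_A (RF6.A_ne hq0 hq).1 ((RF6.eta_all z).1 ▸ ha1 z hz)
  have h2 : ∀ q : ℂ, q ≠ 0 → ‖q‖ < 1 →
      HasSum (fun n : ℕ => (if n = 0 then 0 else (a2 n : ℂ)) * q ^ n) (RF6.A2 q) := by
    intro q hq0 hq
    obtain ⟨z, hz, rfl⟩ := RF6.exists_z hq0 hq
    exact RF6.hasSum_A (RF6.A_ne hq0 hq).2 ((RF6.eta_all z).2 ▸ ha2 z hz)
  have key := RF6.coeff_all n (c := fun n => (11 * (repCount ![1, 1, 1, 2, 4, 4, 4, 4] n : ℂ)) - 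
    ((if n = 0 then 11 else 0) + 8 * (sigmaChi8One n : ℂ) + 
      2 * (if 2 ∣ n then (sigmaOneChi8 (n/2) : ℂ) else 0) + 13 * (if n = 0 then 0 else (a1 n : ℂ))
      + 45 * (if n = 0 then 0 else (a2 n : ℂ)) 
      + 136 * (if 2 ∣ n then (if n / 2 = 0 then 0 else (a1 (n/2) : ℂ)) else 0)
      + 16 * (if 2 ∣ n then (if n / 2 = 0 then 0 else (a2 (n/2) : ℂ)) else 0))) ?_
  · rw [if_neg hn.ne', if_neg hn.ne', if_neg hn.ne'] at key
    unfold half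
    have hq : (11 * (repCount ![1, 1, 1, 2, 4, 4, 4, 4] n : ℚ)) - 
      (8 * (sigmaChi8One n : ℚ) + 
      2 * (if 2 ∣ n then (sigmaOneChi8 (n/2) : ℚ) else 0) + 13 * (a1 n : ℚ)
      + 45 * (a2 n : ℚ)
      + 136 * (if 2 ∣ n then (a1 (n/2) : ℚ) else 0)
      + 16 * (if 2 ∣ n then (a2 (n/2) : ℚ) else 0)) = 0 := by
      by_cases hd : 2 ∣ n
      · have hn2 : n / 2 ≠ 0 := by omega
        simp only [if_pos hd, if_neg hn2] at key ⊢
        rw [zero_add] at key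
        exact_mod_cast key
      · simp only [if_neg hd] at key ⊢
        rw [zero_add] at key
        exact_mod_cast key
    linarith
  · intro q hq0 hq
    have hq02 : q^2 ≠ 0 := pow_ne_zero 2 hq0
    have hq2 := RF6.norm_sq_lt hq
    have r := RF6.rep_sum hq0 hq ![1, 1, 1, 2, 4, 4, 4, 4] (by decide)
    have s1 := RF6.hasSum_LA hq
    have s2 := RF6.half_sum (RF6.hasSum_LB hq2)
    have s3 := h1 q hq0 hq
    have s4 := h2 q hq0 hq
    have s5 := RF6.half_sum (h1 _ hq02 hq2)
    have s6 := RF6.half_sum (h2 _ hq02 hq2)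
    have s0 : HasSum (fun n : ℕ => (if n = 0 then (11:ℂ) else 0) * q ^ n) 11 := by
      have := hasSum_single (f := fun n : ℕ => (if n = 0 then (11:ℂ) else 0) * q ^ n) 0 (by
        intro m hm; simp [hm])
      simpa using this
    have t := (r.mul_left 11).sub ((((((s0.add (s1.mul_left 8)).add (s2.mul_left 2)).add (s3.mul_left 13)).add
      (s4.mul_left 45)).add (s5.mul_left 136)).add (s6.mul_left 16))
    refine RF6.hs_congr t ?_ ?_
    · intro m; ring
    · rw [← RF6.final_poly hq0 hq]
      simp [Fin.prod_univ_succ]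
      ring
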